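/- There is an absolute constant M₀ such that for every real M ≥ M₀ the following holds. Let n ≥ s + t + 110, let f : F_q^n → F_q with 0 < μ(S_t) ≤ q^{−M}, and let b ∈ F_q^n. If there exists a ∈ supp(H) such that the density of S_t in the zoom-in C_{a,b} is at least 1 − 1/(q−1)² − 1/q⁶ − 2000·t·q^{200}·q^{−M/4}, then the density of S_t in the union ∪_{v ∈ supp(H)} C_{v,b} is at least 1 − 1/(q−1)² − 1/q⁶ − 2/(q^{100}(q−1)) − 2000·t·q^{200}·q^{−M/4} − q^{−M/2}. -/

import Mathlib

noncomputable section

open Finset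

/-- Affine maps `F^ℓ → F^n`, given as a pair (linear part matrix, translation). -/
abbrev Aff (F : Type) (n ℓ : ℕ) := Matrix (Fin n) (Fin ℓ) F × (Fin n → F)

/-- Application of an affine map `T = (M, c)`: `x ↦ Mx + c`. -/
def affApp {F : Type} [Field F] {n ℓ : ℕ} (T : Aff F n ℓ) (x : Fin ℓ → F) : Fin n → F :=
  T.1.mulVec x + T.2

/-- Inner product of two functions `F^m → F`. -/
def ip {F : Type} [Field F] [Fintype F] {m : ℕ} (u v : (Fin m → F) → F) : F :=
  ∑ z : Fin m → F, u z * v z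

/-- `g` has degree at most `d` as a function. -/
def fDegLE {F : Type} [Field F] {m : ℕ} (g : (Fin m → F) → F) (d : ℕ) : Prop :=
  ∃ Q : MvPolynomial (Fin m) F, Q.totalDegree ≤ d ∧ ∀ x, MvPolynomial.eval x Q = g x

/-- The defining equation of the polynomial `P`:
`x_1 ⋯ x_{p-1} · P = ∑_{I ⊆ [p-1]} (-1)^{|I|+1} (x_I + x_p)^{q-1}`. -/
def Pdef {F : Type} [Field F] (p q : ℕ) (hp : 0 < p) (P : MvPolynomial (Fin p) F) : Prop :=
  (∏ i : Fin (p - 1), MvPolynomial.X (Fin.castLE (Nat.sub_le p 1) i)) * P =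
    ∑ I : Finset (Fin (p - 1)),
      MvPolynomial.C ((-1 : F) ^ (I.card + 1)) *
        ((∑ i ∈ I, MvPolynomial.X (Fin.castLE (Nat.sub_le p 1) i)) +
          MvPolynomial.X (⟨p - 1, Nat.sub_lt hp one_pos⟩ : Fin p)) ^ (q - 1)

/-- The test polynomial `H_e` as a function on `F^{s+t}`. -/
def Hfun {F : Type} [Field F] {p : ℕ} (P : MvPolynomial (Fin p) F)
    (s t : ℕ) (e : Fin t → ℕ) (x : Fin (s + t) → F) : F :=
  (∏ i ∈ Finset.range (s / p),
    MvPolynomial.eval (fun l : Fin p =>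
      if h : p * i + (l : ℕ) < s + t then x ⟨p * i + (l : ℕ), h⟩ else 0) P) *
  ∏ j : Fin t, x (Fin.natAdd s j) ^ e j

/-- A degree sequence `e ∈ {0, …, q-1}^t` is valid if `∑ e_j ≤ t(q-1) - r`. -/
def validE (q r t : ℕ) (e : Fin t → ℕ) : Prop :=
  (∀ j, e j ≤ q - 1) ∧ ∑ j, e j ≤ t * (q - 1) - r

/-- `T` rejects `f` in the sparse `(s+t)`-flat test. -/
def rejects {F : Type} [Field F] [Fintype F] {p : ℕ} (P : MvPolynomial (Fin p) F)
    (q s r t n : ℕ) (f : (Fin n → F) → F) (T : Aff F n (s + t)) : Prop :=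
  ∃ e : Fin t → ℕ, validE q r t e ∧ ip (fun x => f (affApp T x)) (Hfun P s t e) ≠ 0

/-- Density of `A` inside `C`. -/
def dens {α : Type} (A C : Set α) : ℝ :=
  (Nat.card ↥(A ∩ C) : ℝ) / (Nat.card ↥C : ℝ)

/-- Fractional measure of a set in a (finite) type. -/
def mu {α : Type} (A : Set α) : ℝ :=
  (Nat.card ↥A : ℝ) / (Nat.card α : ℝ)

/-- The union of the supports of the test polynomials `H_e`. -/
def suppH {F : Type} [Field F] [Fintype F] {p : ℕ} (P : MvPolynomial (Fin p) F)
    (q s t : ℕ) : Set (Fin (s + t) → F) :=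
  {x | ∃ e : Fin t → ℕ, (∀ j, e j ≤ q - 1) ∧ Hfun P s t e x ≠ 0}

/-- Edge expansion of a set `S` in the (regular) graph with adjacency `adj`:
the probability that a uniformly random step started in `S` escapes `S`. -/
def expans {α : Type} (adj : α → α → Prop) (S : Set α) : ℝ :=
  (Nat.card {x : α × α // x.1 ∈ S ∧ adj x.1 x.2 ∧ x.2 ∉ S} : ℝ) /
  (Nat.card {x : α × α // x.1 ∈ S ∧ adj x.1 x.2} : ℝ)

/-- Adjacency in the affine bi-linear scheme graph: two distinct affine maps are adjacent
iff their agreement set is an affine subspace of dimension `ℓ - 1`. -/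
def adjBilin {F : Type} [Field F] {n ℓ : ℕ} (T₁ T₂ : Aff F n ℓ) : Prop :=
  T₁ ≠ T₂ ∧ ∃ W : AffineSubspace F (Fin ℓ → F),
    (W : Set (Fin ℓ → F)).Nonempty ∧
    (W : Set (Fin ℓ → F)) = {x | affApp T₁ x = affApp T₂ x} ∧
    Module.finrank F W.direction = ℓ - 1

/-- `W` is an `ℓ`-flat: a nonempty affine subspace of dimension `ℓ`. -/
def IsFlat {F : Type} [Field F] {N : ℕ} (ℓ : ℕ) (W : AffineSubspace F (Fin N → F)) : Prop :=
  (W : Set (Fin N → F)).Nonempty ∧ Module.finrank F W.direction = ℓ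

/-- Adjacency in the affine Grassmann graph `AffGras(N, ℓ)`: two distinct `ℓ`-flats are
adjacent iff their intersection is an `(ℓ-1)`-flat. -/
def adjGras {F : Type} [Field F] {N : ℕ} (ℓ : ℕ) (U V : AffineSubspace F (Fin N → F)) : Prop :=
  U ≠ V ∧ IsFlat ℓ U ∧ IsFlat ℓ V ∧ IsFlat (ℓ - 1) (U ⊓ V)

/-- The minimal fractional Hamming distance from `f` to a function of degree at most `d`. -/
def deltaDist {F : Type} [Field F] [Fintype F] {n : ℕ} (f : (Fin n → F) → F) (d : ℕ) : ℝ :=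
  sInf {x : ℝ | ∃ g : (Fin n → F) → F, fDegLE g d ∧
    x = (Nat.card {y : Fin n → F // f y ≠ g y} : ℝ) / (Fintype.card (Fin n → F) : ℝ)}

open scoped Classical in
theorem sum_addChar_correlation {G : Type*} [AddCommGroup G] [Fintype G] (Z : Finset G) (h : G) :
    ∑ χ : AddChar G ℂ, (∑ g ∈ Z, χ g) * (starRingEnd ℂ) (∑ g ∈ Z, χ g) * χ h =
      Fintype.card G * ((Z.filter fun g => g + h ∈ Z).card : ℂ) := by
  have h1 : ∀ χ : AddChar G ℂ, (∑ g ∈ Z, χ g) * (starRingEnd ℂ) (∑ g ∈ Z, χ g) * χ h =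
      ∑ g ∈ Z, ∑ g' ∈ Z, χ (g + h - g') := by
    intro χ
    rw [map_sum, Finset.sum_mul_sum, Finset.sum_mul]
    refine Finset.sum_congr rfl fun g _ => ?_
    rw [Finset.sum_mul]
    refine Finset.sum_congr rfl fun g' _ => ?_
    rw [sub_eq_add_neg, AddChar.map_add_eq_mul, AddChar.map_add_eq_mul, AddChar.map_neg_eq_conj]
    ring
  simp_rw [h1]
  rw [Finset.sum_comm]
  simp_rw [Finset.sum_comm (s := Finset.univ), AddChar.sum_apply_eq_ite, sub_eq_zero]
  rw [Finset.card_filter, Nat.cast_sum, Finset.mul_sum]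
  refine Finset.sum_congr rfl fun g _ => ?_
  simp

open scoped Classical in
theorem card_correlation_le {G K : Type*} [AddCommGroup G] [Fintype G] [Fintype K] (s : K → G)
    (hs : ∀ χ : AddChar G ℂ, χ ≠ 0 → ‖∑ k, χ (s k)‖ ≤ Fintype.card K / 2) (Z : Finset G) :
    (Fintype.card G : ℝ) * ∑ k, ((Z.filter fun g => g + s k ∈ Z).card : ℝ) ≤
      Fintype.card K / 2 * ((Z.card : ℝ) ^ 2 + Fintype.card G * Z.card) := by
  set E : AddChar G ℂ → ℂ := fun χ => ∑ g ∈ Z, χ g with hE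
  have hpars : ∑ χ, ‖E χ‖ ^ 2 = Fintype.card G * (Z.card : ℝ) := by
    have := sum_addChar_correlation Z 0
    simp only [AddChar.map_zero_eq_one, mul_one, add_zero, Finset.filter_mem_eq_inter,
      Finset.inter_self, Complex.mul_conj, Complex.normSq_eq_norm_sq] at this
    exact_mod_cast this
  have hcorr : ((Fintype.card G : ℂ)) * ∑ k, ((Z.filter fun g => g + s k ∈ Z).card : ℂ) =
      ∑ χ, (E χ * (starRingEnd ℂ) (E χ)) * ∑ k, χ (s k) := by
    rw [Finset.mul_sum]
    simp_rw [Finset.mul_sum]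
    rw [Finset.sum_comm]
    exact Finset.sum_congr rfl fun k _ => (sum_addChar_correlation Z (s k)).symm
  have hnorm : (Fintype.card G : ℝ) * ∑ k, ((Z.filter fun g => g + s k ∈ Z).card : ℝ) ≤
      ∑ χ, ‖E χ‖ ^ 2 * ‖∑ k, χ (s k)‖ := by
    have h2 := congrArg norm hcorr
    have h3 : ‖((Fintype.card G : ℂ)) * ∑ k, ((Z.filter fun g => g + s k ∈ Z).card : ℂ)‖ =
        (Fintype.card G : ℝ) * ∑ k, ((Z.filter fun g => g + s k ∈ Z).card : ℝ) := by
      rw [← Nat.cast_sum, ← Nat.cast_mul, Complex.norm_natCast]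
      push_cast
      rfl
    rw [← h3, h2]
    refine (norm_sum_le _ _).trans (le_of_eq ?_)
    refine Finset.sum_congr rfl fun χ _ => ?_
    rw [norm_mul, norm_mul, RCLike.norm_conj, sq]
  refine hnorm.trans ?_
  have hbound : ∀ χ : AddChar G ℂ, ‖E χ‖ ^ 2 * ‖∑ k, χ (s k)‖ ≤
      Fintype.card K / 2 * (‖E χ‖ ^ 2 + if χ = 0 then (Z.card : ℝ) ^ 2 else 0) := by
    intro χ
    by_cases hχ : χ = 0
    · subst hχ
      simp [hE]
      apply le_of_eq
      ring
    · simp only [hχ, if_false, add_zero]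
      rw [mul_comm]
      exact mul_le_mul_of_nonneg_right (hs χ hχ) (by positivity)
  refine (Finset.sum_le_sum fun χ _ => hbound χ).trans (le_of_eq ?_)
  rw [← Finset.mul_sum, Finset.sum_add_distrib, hpars, Finset.sum_ite_eq' Finset.univ,
    if_pos (Finset.mem_univ _), add_comm]

open scoped Classical in
/-- A function on a finite abelian group that rarely changes along a random step with a spectral gap
is almost constant. -/
theorem exists_card_ne_le_of_spectral_gap {G K C : Type*} [AddCommGroup G] [Fintype G] [Fintype K]
    [Nonempty K] (s : K → G)
    (hs : ∀ χ : AddChar G ℂ, χ ≠ 0 → ‖∑ k, χ (s k)‖ ≤ Fintype.card K / 2) (φ : G → C) (η : ℝ)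
    (h : ((Finset.univ.filter fun x : G × K => φ (x.1 + s x.2) ≠ φ x.1).card : ℝ) ≤
      η * (Fintype.card G * Fintype.card K)) :
    ∃ c, ((Finset.univ.filter fun g => φ g ≠ c).card : ℝ) ≤ 2 * η * Fintype.card G := by
  set N : ℝ := (Fintype.card G : ℝ) with hN
  set k : ℝ := (Fintype.card K : ℝ) with hk
  have hNpos : 0 < N := by
    exact Nat.cast_pos.2 Fintype.card_pos
  have hkpos : 0 < k := by
    exact Nat.cast_pos.2 Fintype.card_pos
  set I : Finset C := Finset.univ.image φ with hI
  set Z : C → Finset G := fun c => Finset.univ.filter fun g => φ g = c with hZ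
  have hsum : ∑ c ∈ I, ((Z c).card : ℝ) = N := by
    have := Finset.card_eq_sum_card_image φ Finset.univ
    rw [Finset.card_univ] at this
    rw [hN]
    exact_mod_cast this.symm
  have heq : ∑ c ∈ I, ∑ j, (((Z c).filter fun g => g + s j ∈ Z c).card : ℝ) =
      ((Finset.univ.filter fun x : G × K => φ (x.1 + s x.2) = φ x.1).card : ℝ) := by
    rw [Finset.sum_comm, Finset.card_filter, Nat.cast_sum, Fintype.sum_prod_type_right]
    refine Finset.sum_congr rfl fun j _ => ?_
    rw [← Nat.cast_sum, ← Nat.cast_sum]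
    congr 1
    rw [← Finset.card_filter,
      Finset.card_eq_sum_card_fiberwise (f := φ) (t := I) (by intro g _; simp [hI])]
    refine Finset.sum_congr rfl fun c _ => congrArg _ ?_
    ext g
    simp only [hZ, Finset.mem_filter, Finset.mem_univ, true_and]
    constructor
    · rintro ⟨h1, h2⟩; exact ⟨h2.trans h1.symm, h1⟩
    · rintro ⟨h1, h2⟩; exact ⟨h2, h1.trans h2⟩
  have hcompl : ((Finset.univ.filter fun x : G × K => φ (x.1 + s x.2) = φ x.1).card : ℝ) +
      ((Finset.univ.filter fun x : G × K => φ (x.1 + s x.2) ≠ φ x.1).card : ℝ) = N * k := by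
    have := Finset.card_filter_add_card_filter_not (s := (Finset.univ : Finset (G × K)))
      (fun x : G × K => φ (x.1 + s x.2) = φ x.1)
    rw [Finset.card_univ, Fintype.card_prod] at this
    rw [hN, hk]
    exact_mod_cast this
  have henergy : N * ((1 - η) * (N * k)) ≤ k / 2 * (∑ c ∈ I, ((Z c).card : ℝ) ^ 2 + N * N) := by
    calc N * ((1 - η) * (N * k))
        ≤ N * ∑ c ∈ I, ∑ j, (((Z c).filter fun g => g + s j ∈ Z c).card : ℝ) := by
          refine mul_le_mul_of_nonneg_left ?_ hNpos.le
          rw [heq]; linarith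
      _ = ∑ c ∈ I, N * ∑ j, (((Z c).filter fun g => g + s j ∈ Z c).card : ℝ) := Finset.mul_sum _ _ _
      _ ≤ ∑ c ∈ I, k / 2 * (((Z c).card : ℝ) ^ 2 + N * (Z c).card) :=
          Finset.sum_le_sum fun c _ => card_correlation_le s hs (Z c)
      _ = k / 2 * (∑ c ∈ I, ((Z c).card : ℝ) ^ 2 + N * N) := by
          rw [← Finset.mul_sum, Finset.sum_add_distrib, ← Finset.mul_sum, hsum]
  have hsq : (1 - 2 * η) * N * N ≤ ∑ c ∈ I, ((Z c).card : ℝ) ^ 2 := by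
    have : k * ((1 - η) * N * N) ≤ k * ((∑ c ∈ I, ((Z c).card : ℝ) ^ 2 + N * N) / 2) := by
      nlinarith [henergy]
    have := le_of_mul_le_mul_left this hkpos
    linarith
  have hIne : I.Nonempty := by
    rw [hI, Finset.image_nonempty]; exact Finset.univ_nonempty
  obtain ⟨c, hcI, hc⟩ := Finset.exists_le_of_sum_le (s := I)
    (f := fun c => (1 - 2 * η) * N * (Z c).card) (g := fun c => ((Z c).card : ℝ) * (Z c).card) hIne
    (by
      rw [← Finset.mul_sum, hsum]
      refine hsq.trans (le_of_eq (Finset.sum_congr rfl fun c _ => sq _)))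
  obtain ⟨g₀, -, hg₀⟩ := Finset.mem_image.1 hcI
  have hZpos : 0 < ((Z c).card : ℝ) := by
    exact_mod_cast Finset.card_pos.2 ⟨g₀, by simp [hZ, hg₀]⟩
  have hZc : (1 - 2 * η) * N ≤ (Z c).card := le_of_mul_le_mul_right hc hZpos
  have hsplit : ((Z c).card : ℝ) + ((Finset.univ.filter fun g => φ g ≠ c).card : ℝ) = N := by
    have := Finset.card_filter_add_card_filter_not (s := (Finset.univ : Finset G))
      (fun g => φ g = c)
    rw [Finset.card_univ] at this
    rw [hN]
    exact_mod_cast this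
  exact ⟨c, by linarith⟩

open scoped Classical in
theorem card_filter_comp_mul_card {V U : Type*} [AddGroup V] [AddGroup U] [Fintype V] [Fintype U]
    (φ : V →+ U) (hφ : Function.Surjective φ) (Z : U → Prop) :
    (univ.filter fun v => Z (φ v)).card * Fintype.card U =
      (univ.filter Z).card * Fintype.card V := by
  have hfib : ∀ u, (univ.filter fun v => φ v = u).card = (univ.filter fun v => φ v = 0).card :=
    fun u => AddMonoidHom.card_fiber_eq_of_mem_range φ (hφ u) (hφ 0)
  have h1 : (univ.filter fun v => Z (φ v)).card =
      (univ.filter Z).card * (univ.filter fun v => φ v = 0).card := by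
    rw [card_eq_sum_card_fiberwise (f := φ) (t := univ.filter Z) (by intro v hv; simpa using hv),
      ← smul_eq_mul, ← sum_const]
    refine sum_congr rfl fun u hu => ?_
    rw [← hfib u, filter_filter]
    refine congrArg _ (filter_congr fun v _ => ?_)
    constructor
    · exact fun h => h.2
    · rintro rfl; exact ⟨(mem_filter.1 hu).2, rfl⟩
  have h2 : Fintype.card V = Fintype.card U * (univ.filter fun v => φ v = 0).card := by
    rw [← card_univ, card_eq_sum_card_fiberwise (f := φ) (t := univ) (by intro v _; simp)]
    simp [hfib]
  rw [h1, h2]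
  ring

/-- The sum of a pullback along a non-injective linear map over a finite field vanishes. -/
theorem sum_comp_eq_zero_of_ker_ne_bot {F V U : Type*} [Field F] [Fintype F] [AddCommGroup V]
    [Module F V] [Fintype V] [AddCommGroup U] [Module F U] [Fintype U] (φ : V →ₗ[F] U)
    (hφ : LinearMap.ker φ ≠ ⊥) (G : U → F) : ∑ v, G (φ v) = 0 := by
  classical
  have hker : ((Fintype.card (LinearMap.ker φ) : ℕ) : F) = 0 := by
    have hpos : Module.finrank F (LinearMap.ker φ) ≠ 0 := fun h =>
      hφ (Submodule.finrank_eq_zero.1 h)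
    rw [Module.card_eq_pow_finrank (K := F), Nat.cast_pow, FiniteField.cast_card_eq_zero,
      zero_pow hpos]
  have hfib0 : (((univ.filter fun v => φ v = 0).card : ℕ) : F) = 0 := by
    rw [← hker, Fintype.card_subtype]
    simp [LinearMap.mem_ker]
  rw [← sum_fiberwise (s := univ) (g := φ)]
  refine sum_eq_zero fun u _ => ?_
  rw [sum_congr rfl fun v hv => by rw [(mem_filter.1 hv).2], sum_const, nsmul_eq_mul]
  by_cases hu : u ∈ Set.range φ
  · have := AddMonoidHom.card_fiber_eq_of_mem_range φ.toAddMonoidHom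
      (x := u) (y := 0) hu ⟨0, map_zero _⟩
    have hcard : (univ.filter fun v => φ v = u).card = (univ.filter fun v => φ v = 0).card := by
      convert this <;> rfl
    rw [hcard, hfib0, zero_mul]
  · rw [filter_eq_empty_iff.2, card_empty, Nat.cast_zero, zero_mul]
    exact fun v _ hv => hu ⟨v, hv⟩

open scoped Classical in
/-- A subset meeting `{L₀ + ∑ j, c j • L j | c ≠ 0}` for every triple `L` has density at least
`1 / |F| ^ 3`. -/
theorem card_le_card_pow_three_mul {F G : Type*} [Field F] [Fintype F] [AddCommGroup G]
    [Module F G] [Fintype G] (B : G → Prop) (L₀ : G)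
    (h : ∀ L : Fin 3 → G, ∃ c : Fin 3 → F, c ≠ 0 ∧ B (L₀ + ∑ j, c j • L j)) :
    Fintype.card G ≤ Fintype.card F ^ 3 * (univ.filter B).card := by
  have hpos : 0 < Fintype.card (Fin 3 → G) := Fintype.card_pos
  have hc : ∀ c : Fin 3 → F, c ≠ 0 →
      (univ.filter fun L : Fin 3 → G => B (L₀ + ∑ j, c j • L j)).card * Fintype.card G =
        (univ.filter B).card * Fintype.card (Fin 3 → G) := by
    intro c hc
    obtain ⟨j, hj⟩ := Function.ne_iff.1 hc
    let φ : (Fin 3 → G) →+ G :=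
      { toFun := fun L => ∑ j, c j • L j
        map_zero' := by simp
        map_add' := fun x y => by simp [smul_add, sum_add_distrib] }
    have hφ : Function.Surjective φ := by
      intro g
      refine ⟨Pi.single j ((c j)⁻¹ • g), ?_⟩
      change ∑ i, c i • (Pi.single j ((c j)⁻¹ • g) : Fin 3 → G) i = g
      rw [sum_eq_single j]
      · rw [Pi.single_eq_same, smul_inv_smul₀ hj]
      · intro i _ hi
        rw [Pi.single_eq_of_ne hi, smul_zero]
      · simp
    refine (card_filter_comp_mul_card φ hφ fun u => B (L₀ + u)).trans ?_
    congr 1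
    refine card_bij' (fun u _ => L₀ + u) (fun u _ => u - L₀) ?_ ?_ ?_ ?_ <;> simp
  have hcover : (univ : Finset (Fin 3 → G)) ⊆ (univ.filter fun c : Fin 3 → F => c ≠ 0).biUnion
      fun c => univ.filter fun L : Fin 3 → G => B (L₀ + ∑ j, c j • L j) := by
    intro L _
    obtain ⟨c, hc, hB⟩ := h L
    simp only [mem_biUnion, mem_filter, mem_univ, true_and]
    exact ⟨c, hc, hB⟩
  have h1 := (card_le_card hcover).trans card_biUnion_le
  have h2 : Fintype.card (Fin 3 → G) * Fintype.card G ≤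
      Fintype.card (Fin 3 → G) * (Fintype.card F ^ 3 * (univ.filter B).card) := by
    calc Fintype.card (Fin 3 → G) * Fintype.card G
        ≤ (∑ c ∈ univ.filter fun c : Fin 3 → F => c ≠ 0,
            (univ.filter fun L : Fin 3 → G => B (L₀ + ∑ j, c j • L j)).card) * Fintype.card G :=
          Nat.mul_le_mul_right _ (by rwa [card_univ] at h1)
      _ = ∑ c ∈ univ.filter fun c : Fin 3 → F => c ≠ 0,
            (univ.filter B).card * Fintype.card (Fin 3 → G) := by
          rw [sum_mul]
          exact sum_congr rfl fun c hc' => hc c (mem_filter.1 hc').2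
      _ ≤ Fintype.card F ^ 3 * ((univ.filter B).card * Fintype.card (Fin 3 → G)) := by
          rw [sum_const, smul_eq_mul]
          refine Nat.mul_le_mul_right _ ((card_filter_le _ _).trans (le_of_eq ?_))
          simp
      _ = _ := by ring
  exact Nat.le_of_mul_le_mul_left h2 hpos

/-- The affine map with linear part `M` sending `a` to `b`. -/
def affThrough {F : Type} [Field F] {n ℓ : ℕ} (b : Fin n → F) (a : Fin ℓ → F)
    (M : Matrix (Fin n) (Fin ℓ) F) : Aff F n ℓ :=
  (M, b - M.mulVec a)

/-- The affine map `x ↦ T x + W (θ x)`. -/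
def perturb {F : Type} [Field F] {n m ℓ : ℕ} (T : Aff F n ℓ) (W : Matrix (Fin n) (Fin m) F)
    (θ : Aff F m ℓ) : Aff F n ℓ :=
  (T.1 + W * θ.1, T.2 + W.mulVec θ.2)

/-- Some test function in the family `H` has nonzero inner product with `f ∘ T`. -/
def Detects {F ι : Type} [Field F] [Fintype F] {n ℓ : ℕ} (f : (Fin n → F) → F)
    (H : ι → (Fin ℓ → F) → F) (T : Aff F n ℓ) : Prop :=
  ∃ i, ip (fun x => f (affApp T x)) (H i) ≠ 0

/-- The perturbations of `affThrough b a M` along `W` that move the image of `a` all pass the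
test. -/
def GoodAt {F ι : Type} [Field F] [Fintype F] {n ℓ : ℕ} (f : (Fin n → F) → F)
    (H : ι → (Fin ℓ → F) → F) (b : Fin n → F) (a : Fin ℓ → F) (M : Matrix (Fin n) (Fin ℓ) F)
    (W : Matrix (Fin n) (Fin 2) F) : Prop :=
  ∀ θ : Aff F 2 ℓ, affApp θ a ≠ 0 → ¬ Detects f H (perturb (affThrough b a M) W θ)

section Perturbation

variable {F ι : Type} [Field F] {n m ℓ : ℕ}

theorem affApp_affThrough (b : Fin n → F) (a : Fin ℓ → F) (M : Matrix (Fin n) (Fin ℓ) F)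
    (x : Fin ℓ → F) : affApp (affThrough b a M) x = b + M.mulVec (x - a) := by
  simp only [affApp, affThrough, Matrix.mulVec_sub]
  abel

theorem affApp_perturb (T : Aff F n ℓ) (W : Matrix (Fin n) (Fin m) F) (θ : Aff F m ℓ)
    (x : Fin ℓ → F) : affApp (perturb T W θ) x = affApp T x + W.mulVec (affApp θ x) := by
  simp only [affApp, perturb, Matrix.mulVec_add, Matrix.add_mulVec, Matrix.mulVec_mulVec]
  abel

theorem perturb_affThrough (b : Fin n → F) (a : Fin ℓ → F) (M : Matrix (Fin n) (Fin ℓ) F)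
    (W : Matrix (Fin n) (Fin m) F) (y : Fin m → F) (L : Matrix (Fin m) (Fin ℓ) F) :
    perturb (affThrough b a M) W (affThrough y a L) =
      affThrough (b + W.mulVec y) a (M + W * L) := by
  simp only [affThrough, perturb, Matrix.mulVec_sub, Matrix.add_mulVec, Matrix.mulVec_mulVec,
    Prod.mk.injEq, true_and]
  abel

theorem eq_affThrough_affApp (T : Aff F n ℓ) (a : Fin ℓ → F) :
    T = affThrough (affApp T a) a T.1 := by
  simp [affThrough, affApp]

variable [Fintype F]

theorem exists_ip_perturb_ne_zero (f : (Fin n → F) → F) (h : (Fin ℓ → F) → F) (T : Aff F n ℓ)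
    (W : Matrix (Fin n) (Fin 2) F) (y : Fin 2 → F) (a : Fin ℓ → F)
    (L₀ : Matrix (Fin 2) (Fin ℓ) F)
    (h₀ : ip (fun x => f (affApp (perturb T W (affThrough y a L₀)) x)) h ≠ 0)
    (L : Fin 3 → Matrix (Fin 2) (Fin ℓ) F) :
    ∃ c : Fin 3 → F, c ≠ 0 ∧
      ip (fun x => f (affApp (perturb T W (affThrough y a (L₀ + ∑ j, c j • L j))) x)) h ≠ 0 := by
  by_contra! hc
  have hsum : ∑ c : Fin 3 → F,
      ip (fun x => f (affApp (perturb T W (affThrough y a (L₀ + ∑ j, c j • L j))) x)) h = 0 := by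
    simp only [ip]
    rw [sum_comm]
    refine sum_eq_zero fun x _ => ?_
    rw [← sum_mul]
    let φ : (Fin 3 → F) →ₗ[F] (Fin 2 → F) :=
      Fintype.linearCombination F fun j => (L j).mulVec (x - a)
    have hφ : LinearMap.ker φ ≠ ⊥ := LinearMap.ker_ne_bot_of_finrank_lt (by simp)
    have := sum_comp_eq_zero_of_ker_ne_bot φ hφ fun u =>
      f (affApp T x + W.mulVec (y + L₀.mulVec (x - a) + u))
    rw [← zero_mul (h x), ← this]
    congr 1
    refine sum_congr rfl fun c _ => ?_
    rw [affApp_perturb, affApp_affThrough, Matrix.add_mulVec, Matrix.sum_mulVec, add_assoc]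
    simp only [Matrix.smul_mulVec, φ, Fintype.linearCombination_apply]
  rw [Fintype.sum_eq_single 0 hc] at hsum
  simp at hsum
  exact h₀ hsum

open scoped Classical in
theorem card_detects_perturb_le (f : (Fin n → F) → F) (H : ι → (Fin ℓ → F) → F) (b : Fin n → F)
    (a : Fin ℓ → F) {y : Fin 2 → F} (hy : y ≠ 0) :
    (univ.filter fun x : Matrix (Fin n) (Fin ℓ) F × Matrix (Fin n) (Fin 2) F =>
        ∃ L, Detects f H (perturb (affThrough b a x.1) x.2 (affThrough y a L))).card *
          Fintype.card (Aff F n ℓ) ≤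
      Fintype.card F ^ 3 * (univ.filter fun T : Aff F n ℓ => Detects f H T).card *
        (Fintype.card (Matrix (Fin n) (Fin ℓ) F) * Fintype.card (Matrix (Fin n) (Fin 2) F)) := by
  set bad := univ.filter fun x : Matrix (Fin n) (Fin ℓ) F × Matrix (Fin n) (Fin 2) F =>
    ∃ L, Detects f H (perturb (affThrough b a x.1) x.2 (affThrough y a L))
  have hCpos : 0 < Fintype.card (Matrix (Fin 2) (Fin ℓ) F) := Fintype.card_pos
  have h1 : bad.card * Fintype.card (Matrix (Fin 2) (Fin ℓ) F) ≤ Fintype.card F ^ 3 *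
      ∑ x : Matrix (Fin n) (Fin ℓ) F × Matrix (Fin n) (Fin 2) F,
        (univ.filter fun L : Matrix (Fin 2) (Fin ℓ) F =>
        Detects f H (perturb (affThrough b a x.1) x.2 (affThrough y a L))).card := by
    rw [← smul_eq_mul, ← sum_const, mul_sum]
    refine (sum_le_sum fun x hx => ?_).trans (sum_le_univ_sum_of_nonneg fun _ => Nat.zero_le _)
    obtain ⟨L₀, i, hi⟩ := (mem_filter.1 hx).2
    refine card_le_card_pow_three_mul _ L₀ fun L => ?_
    obtain ⟨c, hc, h⟩ := exists_ip_perturb_ne_zero f (H i) _ _ y a L₀ hi L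
    exact ⟨c, hc, i, h⟩
  have h2 : ∑ x : Matrix (Fin n) (Fin ℓ) F × Matrix (Fin n) (Fin 2) F,
        (univ.filter fun L : Matrix (Fin 2) (Fin ℓ) F =>
        Detects f H (perturb (affThrough b a x.1) x.2 (affThrough y a L))).card =
      Fintype.card (Matrix (Fin 2) (Fin ℓ) F) *
        (univ.filter fun x : Matrix (Fin n) (Fin ℓ) F × Matrix (Fin n) (Fin 2) F =>
        Detects f H (affThrough (b + x.2.mulVec y) a x.1)).card := by
    simp only [card_filter, perturb_affThrough]
    rw [sum_comm, ← smul_eq_mul, ← card_univ, ← sum_const]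
    refine sum_congr rfl fun L _ => ?_
    rw [Fintype.sum_prod_type_right, Fintype.sum_prod_type_right]
    refine sum_congr rfl fun W _ => ?_
    exact Fintype.sum_equiv (Equiv.addRight (W * L)) _ _ fun M => rfl
  have h3 : (univ.filter fun x : Matrix (Fin n) (Fin ℓ) F × Matrix (Fin n) (Fin 2) F =>
        Detects f H (affThrough (b + x.2.mulVec y) a x.1)).card * Fintype.card (Aff F n ℓ) =
      (univ.filter fun T : Aff F n ℓ => Detects f H T).card *
        (Fintype.card (Matrix (Fin n) (Fin ℓ) F) * Fintype.card (Matrix (Fin n) (Fin 2) F)) := by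
    let φ : Matrix (Fin n) (Fin ℓ) F × Matrix (Fin n) (Fin 2) F →+ Aff F n ℓ :=
      { toFun := fun x => (x.1, x.2.mulVec y - x.1.mulVec a)
        map_zero' := by simp
        map_add' := fun x z => by
          simp only [Prod.fst_add, Prod.snd_add, Matrix.add_mulVec, Prod.mk_add_mk,
            Prod.mk.injEq, true_and]
          abel }
    have hφ : Function.Surjective φ := by
      rintro ⟨M, c⟩
      obtain ⟨j, hj⟩ := Function.ne_iff.1 hy
      refine ⟨(M, Matrix.vecMulVec (c + M.mulVec a) (Pi.single j (y j)⁻¹)), ?_⟩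
      change (M, Matrix.mulVec (Matrix.vecMulVec (c + M.mulVec a) (Pi.single j (y j)⁻¹)) y -
        M.mulVec a) = (M, c)
      rw [Matrix.vecMulVec_mulVec]
      have : y j ≠ 0 := hj
      simp [this]
    have := card_filter_comp_mul_card φ hφ fun T => Detects f H (T + (0, b))
    rw [Fintype.card_prod (Matrix (Fin n) (Fin ℓ) F) (Matrix (Fin n) (Fin 2) F)] at this
    rw [show (univ.filter fun T : Aff F n ℓ => Detects f H T).card =
      (univ.filter fun T : Aff F n ℓ => Detects f H (T + (0, b))).card from ?_, ← this]
    · congr 3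
      ext x
      have : affThrough (b + x.2.mulVec y) a x.1 = φ x + (0, b) := by
        change (x.1, b + x.2.mulVec y - x.1.mulVec a) =
          (x.1 + 0, x.2.mulVec y - x.1.mulVec a + b)
        rw [add_zero, Prod.mk.injEq]
        exact ⟨rfl, by abel⟩
      rw [this]
    · refine card_bij' (fun T _ => T - (0, b)) (fun T _ => T + (0, b)) ?_ ?_ ?_ ?_ <;> simp
  refine le_of_mul_le_mul_left ?_ hCpos
  calc Fintype.card (Matrix (Fin 2) (Fin ℓ) F) * (bad.card * Fintype.card (Aff F n ℓ))
      = bad.card * Fintype.card (Matrix (Fin 2) (Fin ℓ) F) * Fintype.card (Aff F n ℓ) := by ring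
    _ ≤ _ := Nat.mul_le_mul_right _ h1
    _ = Fintype.card (Matrix (Fin 2) (Fin ℓ) F) * (Fintype.card F ^ 3 *
        ((univ.filter fun x : Matrix (Fin n) (Fin ℓ) F × Matrix (Fin n) (Fin 2) F =>
        Detects f H (affThrough (b + x.2.mulVec y) a x.1)).card *
          Fintype.card (Aff F n ℓ))) := by rw [h2]; ring
    _ = _ := by rw [h3]; ring

open scoped Classical in
theorem card_not_goodAt_le (f : (Fin n → F) → F) (H : ι → (Fin ℓ → F) → F) (b : Fin n → F)
    (a : Fin ℓ → F) :
    (univ.filter fun x : Matrix (Fin n) (Fin ℓ) F × Matrix (Fin n) (Fin 2) F =>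
        ¬ GoodAt f H b a x.1 x.2).card * Fintype.card (Aff F n ℓ) ≤
      Fintype.card F ^ 5 * (univ.filter fun T : Aff F n ℓ => Detects f H T).card *
        (Fintype.card (Matrix (Fin n) (Fin ℓ) F) * Fintype.card (Matrix (Fin n) (Fin 2) F)) := by
  have hcover : (univ.filter fun x : Matrix (Fin n) (Fin ℓ) F × Matrix (Fin n) (Fin 2) F =>
        ¬ GoodAt f H b a x.1 x.2) ⊆ (univ.filter fun y : Fin 2 → F => y ≠ 0).biUnion fun y =>
      univ.filter fun x : Matrix (Fin n) (Fin ℓ) F × Matrix (Fin n) (Fin 2) F =>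
        ∃ L, Detects f H (perturb (affThrough b a x.1) x.2 (affThrough y a L)) := by
    intro x hx
    simp only [GoodAt, mem_filter, mem_univ, true_and, not_forall, not_not] at hx
    obtain ⟨θ, hθ, h⟩ := hx
    simp only [mem_biUnion, mem_filter, mem_univ, true_and]
    refine ⟨affApp θ a, hθ, θ.1, ?_⟩
    rwa [← eq_affThrough_affApp]
  have h1 := (card_le_card hcover).trans card_biUnion_le
  refine (Nat.mul_le_mul_right _ h1).trans ?_
  rw [sum_mul]
  refine (sum_le_sum fun y hy => card_detects_perturb_le f H b a (mem_filter.1 hy).2).trans ?_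
  rw [sum_const, smul_eq_mul]
  calc _ ≤ Fintype.card F ^ 2 * _ :=
        Nat.mul_le_mul_right _ ((card_filter_le _ _).trans (le_of_eq (by simp)))
    _ = _ := by ring

end Perturbation

/-- The inner products of `f ∘ T` with the test functions. -/
def testValues {F ι : Type} [Field F] [Fintype F] {n ℓ : ℕ} (f : (Fin n → F) → F)
    (H : ι → (Fin ℓ → F) → F) (T : Aff F n ℓ) : ι → F :=
  fun i => ip (fun x => f (affApp T x)) (H i)

section Zoom

variable {F ι : Type} [Field F] [Fintype F] {n ℓ : ℕ} {f : (Fin n → F) → F}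
  {H : ι → (Fin ℓ → F) → F} {b : Fin n → F}

theorem detects_iff_testValues_ne_zero (T : Aff F n ℓ) : Detects f H T ↔ testValues f H T ≠ 0 :=
  Function.ne_iff.symm

theorem GoodAt.testValues_perturb {a : Fin ℓ → F} {M : Matrix (Fin n) (Fin ℓ) F}
    {W : Matrix (Fin n) (Fin 2) F} (hgood : GoodAt f H b a M W) {θ : Aff F 2 ℓ}
    (hθ : affApp θ a = 0) :
    testValues f H (perturb (affThrough b a M) W θ) = testValues f H (affThrough b a M) := by
  have key : ∀ θ : Aff F 2 ℓ, affApp θ a = 0 → ∀ i,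
      testValues f H (perturb (affThrough b a M) W θ) i =
        ∑ x, (∑ y, f (affApp (affThrough b a M) x + W.mulVec y)) * H i x := by
    intro θ hθ i
    have hsum : ∑ z : Fin 2 → F,
        testValues f H (perturb (affThrough b a M) W (θ + (0, z))) i =
          ∑ x, (∑ y, f (affApp (affThrough b a M) x + W.mulVec y)) * H i x := by
      simp only [testValues, ip]
      rw [sum_comm]
      refine sum_congr rfl fun x _ => ?_
      rw [← sum_mul]
      congr 1
      refine Fintype.sum_equiv (Equiv.addLeft (affApp θ x)) _ _ fun z => ?_
      rw [affApp_perturb]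
      simp only [affApp, Prod.fst_add, Prod.snd_add, add_zero, Equiv.coe_addLeft, add_assoc]
    rw [← hsum, Fintype.sum_eq_single 0]
    · rw [Prod.mk_zero_zero, add_zero]
    · intro z hz
      by_contra hne
      refine hgood (θ + (0, z)) ?_ ⟨i, hne⟩
      have : affApp (θ + (0, z)) a = affApp θ a + z := by
        simp only [affApp, Prod.fst_add, Prod.snd_add, add_zero, add_assoc]
      rwa [this, hθ, zero_add]
  have hzero : perturb (affThrough b a M) W 0 = affThrough b a M := by
    simp [perturb]
  funext i
  rw [key θ hθ i, ← key 0 (by simp [affApp]) i, hzero]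

end Zoom

theorem norm_sum_addChar_mul_le {F : Type*} [Field F] [Fintype F] {n m ℓ : ℕ} (hm : 0 < m)
    (χ : AddChar (Matrix (Fin n) (Fin ℓ) F) ℂ) (hχ : χ ≠ 0) :
    ‖∑ k : Matrix (Fin n) (Fin m) F × Matrix (Fin m) (Fin ℓ) F, χ (k.1 * k.2)‖ ≤
      Fintype.card (Matrix (Fin n) (Fin m) F × Matrix (Fin m) (Fin ℓ) F) / 2 := by
  classical
  let φ : Matrix (Fin n) (Fin m) F → AddChar (Matrix (Fin m) (Fin ℓ) F) ℂ := fun W =>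
    { toFun := fun L => χ (W * L)
      map_zero_eq_one' := by simp
      map_add_eq_mul' := fun L L' => by rw [Matrix.mul_add, AddChar.map_add_eq_mul] }
  have hφ : ∀ W L, φ W L = χ (W * L) := fun _ _ => rfl
  obtain ⟨W₀, hW₀⟩ : ∃ W, φ W ≠ 0 := by
    by_contra! hall
    refine hχ (DFunLike.ext _ _ fun M => ?_)
    have hsingle : ∀ i j, χ (Matrix.single i j (M i j)) = 1 := by
      intro i j
      have := congrArg (fun ψ => ψ (Matrix.single (⟨0, hm⟩ : Fin m) j (M i j)))
        (hall (Matrix.single i ⟨0, hm⟩ 1))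
      simpa [hφ] using this
    rw [Matrix.matrix_eq_sum_single M]
    have hmap : ∀ {κ : Type} [Fintype κ] (g : κ → Matrix (Fin n) (Fin ℓ) F),
        (∀ i, χ (g i) = 1) → χ (∑ i, g i) = 1 := fun g hg =>
      sum_induction g (fun M => χ M = 1)
        (fun _ _ h h' => by rw [AddChar.map_add_eq_mul, h, h', one_mul])
        (AddChar.map_zero_eq_one χ) fun i _ => hg i
    exact hmap _ fun i => hmap _ fun j => hsingle i j
  set Z : Finset (Matrix (Fin n) (Fin m) F) := univ.filter fun W => φ W = 0 with hZ
  have hZcard : 2 * Z.card ≤ Fintype.card (Matrix (Fin n) (Fin m) F) := by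
    have hdisj : Disjoint Z (Z.image fun W => W + W₀) := by
      rw [disjoint_left]
      intro W hW hW'
      obtain ⟨W', hW'', rfl⟩ := mem_image.1 hW'
      refine hW₀ (DFunLike.ext _ _ fun L => ?_)
      have h1 := congrArg (fun ψ : AddChar (Matrix (Fin m) (Fin ℓ) F) ℂ => ψ L) (mem_filter.1 hW).2
      have h2 := congrArg (fun ψ : AddChar (Matrix (Fin m) (Fin ℓ) F) ℂ => ψ L)
        (mem_filter.1 hW'').2
      simp only [hφ, Matrix.add_mul, AddChar.map_add_eq_mul, AddChar.zero_apply] at h1 h2 ⊢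
      rwa [h2, one_mul] at h1
    have := card_le_univ (Z ∪ Z.image fun W => W + W₀)
    rw [card_union_of_disjoint hdisj, card_image_of_injective _ (add_left_injective W₀)] at this
    omega
  have hnorm : ‖∑ k : Matrix (Fin n) (Fin m) F × Matrix (Fin m) (Fin ℓ) F, χ (k.1 * k.2)‖ =
      Z.card * Fintype.card (Matrix (Fin m) (Fin ℓ) F) := by
    rw [Fintype.sum_prod_type]
    simp_rw [← hφ, AddChar.sum_eq_ite]
    rw [← sum_filter, sum_const, nsmul_eq_mul, norm_mul, Complex.norm_natCast,
      Complex.norm_natCast]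
  rw [hnorm, Fintype.card_prod]
  have : (2 * Z.card : ℝ) ≤ Fintype.card (Matrix (Fin n) (Fin m) F) := by exact_mod_cast hZcard
  push_cast
  nlinarith [(Nat.cast_nonneg (Fintype.card (Matrix (Fin m) (Fin ℓ) F)) : (0 : ℝ) ≤ _)]

section Transfer

variable {F ι : Type} [Field F] [Fintype F] {n ℓ : ℕ} {f : (Fin n → F) → F}
  {H : ι → (Fin ℓ → F) → F} {b : Fin n → F} {η : ℝ}

open scoped Classical in
/-- `η` bounds `|F| ^ 5` times the density of the set of detecting affine maps. -/
def DensityBound {F ι : Type} [Field F] [Fintype F] {n ℓ : ℕ} (f : (Fin n → F) → F)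
    (H : ι → (Fin ℓ → F) → F) (η : ℝ) : Prop :=
  (Fintype.card F : ℝ) ^ 5 * ((univ.filter fun T : Aff F n ℓ => Detects f H T).card : ℝ) ≤
    η * Fintype.card (Aff F n ℓ)

open scoped Classical in
theorem DensityBound.card_not_goodAt_le (hη : DensityBound f H η) (b : Fin n → F)
    (a : Fin ℓ → F) :
    ((univ.filter fun x : Matrix (Fin n) (Fin ℓ) F × Matrix (Fin n) (Fin 2) F =>
        ¬ GoodAt f H b a x.1 x.2).card : ℝ) ≤
      η * (Fintype.card (Matrix (Fin n) (Fin ℓ) F) * Fintype.card (Matrix (Fin n) (Fin 2) F)) := by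
  have hpos : (0 : ℝ) < Fintype.card (Aff F n ℓ) := Nat.cast_pos.2 Fintype.card_pos
  have h1 : ((univ.filter fun x : Matrix (Fin n) (Fin ℓ) F × Matrix (Fin n) (Fin 2) F =>
        ¬ GoodAt f H b a x.1 x.2).card : ℝ) * Fintype.card (Aff F n ℓ) ≤
      (Fintype.card F : ℝ) ^ 5 * ((univ.filter fun T : Aff F n ℓ => Detects f H T).card : ℝ) *
        (Fintype.card (Matrix (Fin n) (Fin ℓ) F) * Fintype.card (Matrix (Fin n) (Fin 2) F)) := by
    exact_mod_cast _root_.card_not_goodAt_le f H b a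
  refine le_of_mul_le_mul_right (h1.trans ?_) hpos
  calc _ ≤ η * Fintype.card (Aff F n ℓ) * (Fintype.card (Matrix (Fin n) (Fin ℓ) F) *
          Fintype.card (Matrix (Fin n) (Fin 2) F) : ℝ) :=
        mul_le_mul_of_nonneg_right hη (by positivity)
    _ = _ := by ring

open scoped Classical in
/-- `v x` is the value of `testValues f H` at most affine maps sending `x` to `b`. -/
def IsTypicalValue {F ι : Type} [Field F] [Fintype F] {n ℓ : ℕ} (f : (Fin n → F) → F)
    (H : ι → (Fin ℓ → F) → F) (b : Fin n → F) (η : ℝ) (v : (Fin ℓ → F) → ι → F) : Prop :=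
  ∀ x, ((univ.filter fun M : Matrix (Fin n) (Fin ℓ) F =>
    testValues f H (affThrough b x M) ≠ v x).card : ℝ) ≤
      2 * η * Fintype.card (Matrix (Fin n) (Fin ℓ) F)

theorem DensityBound.exists_isTypicalValue (hη : DensityBound f H η) (b : Fin n → F) :
    ∃ v, IsTypicalValue f H b η v := by
  classical
  refine Classical.skolem.1 fun x => exists_card_ne_le_of_spectral_gap
    (K := Matrix (Fin n) (Fin 2) F × Matrix (Fin 2) (Fin ℓ) F) (fun k => k.1 * k.2)
    (norm_sum_addChar_mul_le two_pos) (fun M => testValues f H (affThrough b x M)) η ?_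
  have hsub : (univ.filter fun z : Matrix (Fin n) (Fin ℓ) F ×
        (Matrix (Fin n) (Fin 2) F × Matrix (Fin 2) (Fin ℓ) F) =>
        testValues f H (affThrough b x (z.1 + z.2.1 * z.2.2)) ≠
          testValues f H (affThrough b x z.1)).card ≤
      ((univ.filter fun z : Matrix (Fin n) (Fin ℓ) F × Matrix (Fin n) (Fin 2) F =>
        ¬ GoodAt f H b x z.1 z.2) ×ˢ (univ : Finset (Matrix (Fin 2) (Fin ℓ) F))).card := by
    refine card_le_card_of_injOn (fun z => ((z.1, z.2.1), z.2.2)) ?_ ?_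
    · rintro ⟨M, W, L⟩ hz
      simp only [coe_filter, mem_univ, true_and, Set.mem_ofPred_eq] at hz
      simp only [coe_product, coe_filter, coe_univ, mem_univ, true_and, Set.mem_prod,
        Set.mem_ofPred_eq, Set.mem_univ, and_true]
      intro hgood
      apply hz
      have := hgood.testValues_perturb (θ := affThrough 0 x L) (by simp [affApp_affThrough])
      rwa [perturb_affThrough, Matrix.mulVec_zero, add_zero] at this
    · rintro ⟨M, W, L⟩ _ ⟨M', W', L'⟩ _ h
      simp only [Prod.mk.injEq] at h ⊢
      tauto
  refine (Nat.cast_le.2 hsub).trans ?_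
  rw [card_product, Nat.cast_mul, card_univ, Fintype.card_prod, Nat.cast_mul]
  calc _ ≤ η * (Fintype.card (Matrix (Fin n) (Fin ℓ) F) *
          Fintype.card (Matrix (Fin n) (Fin 2) F)) *
            (Fintype.card (Matrix (Fin 2) (Fin ℓ) F) : ℝ) :=
        mul_le_mul_of_nonneg_right (hη.card_not_goodAt_le b x) (Nat.cast_nonneg _)
    _ = _ := by ring

end Transfer

open scoped Classical in
/-- The function `A` on `F ^ ℓ`, viewed as a function of `(x, y)` constant in `y`, is a linear
combination of indicators of graphs of affine maps `F ^ ℓ → F ^ 2`. -/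
def IsMultiplier {F : Type} [Field F] {ℓ : ℕ} (A : (Fin ℓ → F) → F) : Prop :=
  (fun z : (Fin ℓ → F) × (Fin 2 → F) => A z.1) ∈
    Submodule.span F (Set.range fun (θ : Aff F 2 ℓ) (z : (Fin ℓ → F) × (Fin 2 → F)) =>
      if affApp θ z.1 = z.2 then (1 : F) else 0)

namespace IsMultiplier

variable {F : Type} [Field F] {ℓ : ℕ} {A B : (Fin ℓ → F) → F}

theorem sub (hA : IsMultiplier A) (hB : IsMultiplier B) : IsMultiplier (fun x => A x - B x) :=
  Submodule.sub_mem _ hA hB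

theorem const_mul (c : F) (hA : IsMultiplier A) : IsMultiplier (fun x => c * A x) :=
  Submodule.smul_mem _ c hA

theorem sum {κ : Type*} (s : Finset κ) {A : κ → (Fin ℓ → F) → F}
    (hA : ∀ k ∈ s, IsMultiplier (A k)) : IsMultiplier (fun x => ∑ k ∈ s, A k x) := by
  have := Submodule.sum_mem _ hA
  rw [IsMultiplier]
  convert this using 1
  ext z
  simp

theorem comp_add_right (hA : IsMultiplier A) (δ : Fin ℓ → F) :
    IsMultiplier (fun x => A (x + δ)) := by
  classical
  let τ : (((Fin ℓ → F) × (Fin 2 → F)) → F) →ₗ[F] (((Fin ℓ → F) × (Fin 2 → F)) → F) :=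
    LinearMap.funLeft F F fun z => (z.1 + δ, z.2)
  have h := Submodule.mem_map_of_mem (f := τ) hA
  rw [Submodule.map_span] at h
  refine Submodule.span_mono ?_ h
  rintro _ ⟨_, ⟨θ, rfl⟩, rfl⟩
  refine ⟨(θ.1, affApp θ δ), funext fun z => ?_⟩
  have : affApp (θ.1, affApp θ δ) z.1 = affApp θ (z.1 + δ) := by
    simp only [affApp, Matrix.mulVec_add, add_assoc]
  simp only [this]
  rfl

open scoped Classical in
theorem indicator [Fintype F] (θ : Aff F 2 ℓ) :
    IsMultiplier (fun x => if affApp θ x = 0 then (1 : F) else 0) := by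
  let w : F × F → F := fun u => (if u.1 = 0 then 1 else 0) - (if u.2 = 0 then 1 else 0)
  have hw : ∀ ξ y : F, ∑ u : F × F, w u * (if u.1 * ξ + u.2 = y then (1 : F) else 0) =
      if ξ = 0 then 1 else 0 := by
    intro ξ y
    simp only [w, sub_mul, sum_sub_distrib]
    have h1 : ∑ u : F × F, (if u.1 = 0 then (1 : F) else 0) *
        (if u.1 * ξ + u.2 = y then (1 : F) else 0) = 1 := by
      rw [Fintype.sum_prod_type, Fintype.sum_eq_single 0 (by intro d hd; simp [hd])]
      simp
    have h2 : ∑ u : F × F, (if u.2 = 0 then (1 : F) else 0) *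
        (if u.1 * ξ + u.2 = y then (1 : F) else 0) = if ξ = 0 then 0 else 1 := by
      rw [Fintype.sum_prod_type_right]
      rw [Fintype.sum_eq_single 0 (by intro c hc; simp [hc])]
      simp only [↓reduceIte, one_mul, add_zero]
      split_ifs with hξ
      · simp [hξ]
      · rw [Fintype.sum_eq_single (y / ξ)]
        · rw [div_mul_cancel₀ _ hξ, if_pos rfl]
        · intro d hd
          rw [if_neg]
          exact fun h => hd (eq_div_of_mul_eq hξ h)
    rw [h1, h2]
    split_ifs <;> simp
  let T : (Fin 2 → F × F) → Aff F 2 ℓ := fun u =>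
    (Matrix.of fun i j => (u i).1 * θ.1 i j, fun i => (u i).1 * θ.2 i + (u i).2)
  have hT : ∀ u x i, affApp (T u) x i = (u i).1 * affApp θ x i + (u i).2 := by
    intro u x i
    simp only [affApp, T, Pi.add_apply, Matrix.mulVec, dotProduct, Matrix.of_apply, mul_add,
      mul_sum, mul_assoc, add_assoc]
  have hmem : (fun z : (Fin ℓ → F) × (Fin 2 → F) => if affApp θ z.1 = 0 then (1 : F) else 0) =
      ∑ u : Fin 2 → F × F, (w (u 0) * w (u 1)) •
        fun z : (Fin ℓ → F) × (Fin 2 → F) => if affApp (T u) z.1 = z.2 then (1 : F) else 0 := by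
    ext ⟨x, y⟩
    have hprod : ∀ (α β : Fin 2 → F), (if α = β then (1 : F) else 0) =
        (if α 0 = β 0 then 1 else 0) * (if α 1 = β 1 then 1 else 0) := by
      intro α β
      simp only [funext_iff, Fin.forall_fin_two]
      split_ifs <;> simp_all
    simp only [Finset.sum_apply, Pi.smul_apply, smul_eq_mul]
    rw [hprod, Pi.zero_apply, Pi.zero_apply, ← hw _ (y 0), ← hw _ (y 1), sum_mul_sum]
    simp only [hprod (affApp _ _), hT]
    rw [← Fintype.sum_prod_type']
    refine Fintype.sum_equiv (finTwoArrowEquiv (F × F)).symm _ _ fun u => ?_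
    simp only [finTwoArrowEquiv_symm_apply, Matrix.cons_val_zero, Matrix.cons_val_one]
    ring
  rw [IsMultiplier, hmem]
  exact Submodule.sum_mem _ fun u _ => Submodule.smul_mem _ _ (Submodule.subset_span ⟨T u, rfl⟩)

open scoped Classical in
theorem indicator_and [Fintype F] (α α' : Fin ℓ → F) (c c' : F) :
    IsMultiplier (fun x => if α ⬝ᵥ x + c = 0 ∧ α' ⬝ᵥ x + c' = 0 then (1 : F) else 0) := by
  convert indicator ((Matrix.of ![α, α'], ![c, c']) : Aff F 2 ℓ) using 4 with x
  rw [funext_iff, Fin.forall_fin_two]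
  simp [affApp]

end IsMultiplier

section Transfer

variable {F ι : Type} [Field F] [Fintype F] {n ℓ : ℕ} {f : (Fin n → F) → F}
  {H : ι → (Fin ℓ → F) → F} {b : Fin n → F} {η : ℝ}

theorem GoodAt.sum_mul_multiplier {a : Fin ℓ → F} {M : Matrix (Fin n) (Fin ℓ) F}
    {W : Matrix (Fin n) (Fin 2) F} (hgood : GoodAt f H b a M W) {A : (Fin ℓ → F) → F}
    (hA : IsMultiplier A) (i : ι) :
    ∑ x, ∑ y, f (affApp (affThrough b a M) x + W.mulVec y) * (A x * H i x) =
      A a * testValues f H (affThrough b a M) i := by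
  classical
  suffices h : ∀ κ ∈ Submodule.span F (Set.range
      fun (θ : Aff F 2 ℓ) (z : (Fin ℓ → F) × (Fin 2 → F)) =>
        if affApp θ z.1 = z.2 then (1 : F) else 0),
      ∑ x, ∑ y, f (affApp (affThrough b a M) x + W.mulVec y) * (κ (x, y) * H i x) =
        κ (a, 0) * testValues f H (affThrough b a M) i from h _ hA
  intro κ hκ
  induction hκ using Submodule.span_induction with
  | mem κ h =>
    obtain ⟨θ, rfl⟩ := h
    have hlhs : ∑ x, ∑ y, f (affApp (affThrough b a M) x + W.mulVec y) *
        ((if affApp θ x = y then (1 : F) else 0) * H i x) =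
        testValues f H (perturb (affThrough b a M) W θ) i := by
      simp only [testValues, ip, affApp_perturb]
      refine sum_congr rfl fun x _ => ?_
      simp
    simp only
    rw [hlhs]
    split_ifs with h
    · rw [hgood.testValues_perturb h, one_mul]
    · rw [zero_mul]
      by_contra hne
      exact hgood θ h ⟨i, hne⟩
  | zero => simp
  | add κ κ' _ _ h h' =>
    simp only [Pi.add_apply, add_mul, mul_add, sum_add_distrib, h, h']
  | smul c κ _ h =>
    simp only [Pi.smul_apply, smul_eq_mul, mul_assoc]
    rw [← h, mul_sum]
    refine sum_congr rfl fun x _ => ?_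
    rw [mul_sum]
    exact sum_congr rfl fun y _ => by ring

open scoped Classical in
theorem exists_not_of_card_lt {α : Type*} [Fintype α] (p : Fin 4 → α → Prop)
    (h : ∑ i, (univ.filter (p i)).card < Fintype.card α) : ∃ x, ∀ i, ¬ p i x := by
  by_contra! hp
  have : (univ : Finset α) ⊆ univ.biUnion fun i => univ.filter (p i) := by
    intro x _
    obtain ⟨i, hi⟩ := hp x
    exact mem_biUnion.2 ⟨i, mem_univ _, by simpa using hi⟩
  have := (card_le_card this).trans card_biUnion_le
  rw [card_univ] at this
  omega

theorem IsTypicalValue.transfer {v : (Fin ℓ → F) → ι → F} (hv : IsTypicalValue f H b η v)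
    (hη : DensityBound f H η) (hη6 : 6 * η < 1) {A B : (Fin ℓ → F) → F} (hA : IsMultiplier A)
    (hB : IsMultiplier B) (δ : Fin ℓ → F) {i j : ι}
    (hAB : ∀ x, A x * H i x = B x * H j (x + δ)) (a : Fin ℓ → F) :
    A a * v a i = B a * v (a + δ) j := by
  classical
  let p : Fin 4 → Matrix (Fin n) (Fin ℓ) F × Matrix (Fin n) (Fin 2) F → Prop :=
    ![fun z => ¬ GoodAt f H b a z.1 z.2, fun z => ¬ GoodAt f H b (a + δ) z.1 z.2,
      fun z => testValues f H (affThrough b a z.1) ≠ v a,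
      fun z => testValues f H (affThrough b (a + δ) z.1) ≠ v (a + δ)]
  have hcard : ∀ x, ((univ.filter fun z : Matrix (Fin n) (Fin ℓ) F × Matrix (Fin n) (Fin 2) F =>
      testValues f H (affThrough b x z.1) ≠ v x).card : ℝ) ≤
        2 * η * (Fintype.card (Matrix (Fin n) (Fin ℓ) F) *
          Fintype.card (Matrix (Fin n) (Fin 2) F)) := by
    intro x
    have : (univ.filter fun z : Matrix (Fin n) (Fin ℓ) F × Matrix (Fin n) (Fin 2) F =>
        testValues f H (affThrough b x z.1) ≠ v x) =
        (univ.filter fun M => testValues f H (affThrough b x M) ≠ v x) ×ˢ univ := by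
      ext z
      simp
    rw [this, card_product, Nat.cast_mul, card_univ, ← mul_assoc]
    exact mul_le_mul_of_nonneg_right (hv x) (Nat.cast_nonneg _)
  have hlt : ∑ k, (univ.filter (p k)).card <
      Fintype.card (Matrix (Fin n) (Fin ℓ) F × Matrix (Fin n) (Fin 2) F) := by
    have h0 := hη.card_not_goodAt_le b a
    have h1 := hη.card_not_goodAt_le b (a + δ)
    have h2 := hcard a
    have h3 := hcard (a + δ)
    set N : ℝ := (Fintype.card (Matrix (Fin n) (Fin ℓ) F) : ℝ) *
      (Fintype.card (Matrix (Fin n) (Fin 2) F) : ℝ) with hN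
    have hpos : 0 < N :=
      mul_pos (Nat.cast_pos.2 Fintype.card_pos) (Nat.cast_pos.2 Fintype.card_pos)
    rw [Fin.sum_univ_four, ← Nat.cast_lt (α := ℝ), Fintype.card_prod]
    push_cast
    have h0' : ((univ.filter (p 0)).card : ℝ) ≤ η * N := by convert h0
    have h1' : ((univ.filter (p 1)).card : ℝ) ≤ η * N := by convert h1
    have h2' : ((univ.filter (p 2)).card : ℝ) ≤ 2 * η * N := by convert h2
    have h3' : ((univ.filter (p 3)).card : ℝ) ≤ 2 * η * N := by convert h3
    nlinarith
  obtain ⟨⟨M, W⟩, hMW⟩ := exists_not_of_card_lt p hlt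
  have hg : GoodAt f H b a M W := not_not.1 (hMW 0)
  have hg' : GoodAt f H b (a + δ) M W := not_not.1 (hMW 1)
  have ha : testValues f H (affThrough b a M) = v a := not_not.1 (hMW 2)
  have ha' : testValues f H (affThrough b (a + δ) M) = v (a + δ) := not_not.1 (hMW 3)
  have h1 := hg.sum_mul_multiplier hA i
  have h2 := hg'.sum_mul_multiplier (hB.comp_add_right (-δ)) j
  rw [ha] at h1
  rw [ha', add_neg_cancel_right] at h2
  rw [← h1, ← h2]
  refine Fintype.sum_equiv (Equiv.addRight δ) _ _ fun x => ?_
  simp only [Equiv.coe_addRight, add_neg_cancel_right, hAB, affApp_affThrough,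
    add_sub_add_right_eq_sub]

theorem IsTypicalValue.sum_line_eq_zero {v : (Fin ℓ → F) → ι → F}
    (hv : IsTypicalValue f H b η v) (hη : 2 * η * Fintype.card F < 1) {e : Fin ℓ → F} {i : ι}
    (hH : ∀ x, ∑ c : F, H i (x + c • e) = 0) (a : Fin ℓ → F) :
    ∑ c : F, v (a + c • e) i = 0 := by
  classical
  have hpos : (0 : ℝ) < Fintype.card (Matrix (Fin n) (Fin ℓ) F) := Nat.cast_pos.2 Fintype.card_pos
  obtain ⟨M, hM⟩ : ∃ M : Matrix (Fin n) (Fin ℓ) F, ∀ c : F,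
      testValues f H (affThrough b (a + c • e) M) = v (a + c • e) := by
    by_contra! hbad
    have hcover : (univ : Finset (Matrix (Fin n) (Fin ℓ) F)) ⊆ (univ : Finset F).biUnion fun c =>
        univ.filter fun M => testValues f H (affThrough b (a + c • e) M) ≠ v (a + c • e) := by
      intro M _
      obtain ⟨c, hc⟩ := hbad M
      simp only [mem_biUnion, mem_filter, mem_univ, true_and]
      exact ⟨c, hc⟩
    have h1 := (card_le_card hcover).trans card_biUnion_le
    rw [card_univ, ← Nat.cast_le (α := ℝ), Nat.cast_sum] at h1
    have h2 := h1.trans (sum_le_sum fun c _ => hv (a + c • e))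
    rw [sum_const, card_univ, nsmul_eq_mul] at h2
    nlinarith
  have key : ∀ c : F, v (a + c • e) i =
      ∑ x, f (affApp (affThrough b a M) x) * H i (x + c • e) := by
    intro c
    rw [← hM c]
    refine (Fintype.sum_equiv (Equiv.addRight (c • e)) _ _ fun x => ?_).symm
    simp only [Equiv.coe_addRight, affApp_affThrough, add_sub_add_right_eq_sub]
  simp only [key]
  rw [sum_comm]
  simp only [← mul_sum, hH, mul_zero, sum_const_zero]

end Transfer

open Polynomial in
theorem natDegree_taylor_sub_le {F : Type*} [Field F] {f : F[X]} {n : ℕ} {z : F}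
    (hdeg : f.natDegree ≤ n + 1) (hcoeff : f.coeff (n + 1) ≠ 0) (hn : ((n + 1 : ℕ) : F) ≠ 0)
    (hz : z ≠ 0) :
    (f - taylor z f).natDegree ≤ n ∧ (f - taylor z f).coeff n ≠ 0 := by
  have htop : (taylor z f).coeff (n + 1) = f.coeff (n + 1) := by
    rw [taylor_coeff, eval_eq_sum_range' (n := 1)]
    · simp [hasseDeriv_coeff]
    · have := natDegree_hasseDeriv_le f (n + 1)
      omega
  have hnext : (taylor z f).coeff n = f.coeff n + ((n + 1 : ℕ) : F) * f.coeff (n + 1) * z := by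
    rw [taylor_coeff, eval_eq_sum_range' (n := 2)]
    · simp [hasseDeriv_coeff, sum_range_succ, add_comm 1 n]
    · have := natDegree_hasseDeriv_le f n
      omega
  constructor
  · rw [natDegree_le_iff_coeff_eq_zero]
    intro N hN
    rw [coeff_sub]
    rcases (Nat.succ_le_of_lt hN).eq_or_lt with rfl | hN'
    · rw [htop, sub_self]
    · rw [coeff_eq_zero_of_natDegree_lt (by omega), coeff_eq_zero_of_natDegree_lt
        (by rw [natDegree_taylor]; omega), sub_self]
  · rw [coeff_sub, hnext, sub_add_cancel_left, neg_ne_zero]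
    exact mul_ne_zero (mul_ne_zero hn hcoeff) hz

open Polynomial in
/-- Alternating sums of fewer than `p` shifts of `X ^ (q - 1)` are nonzero. -/
theorem natDegree_sum_powerset_le {F κ : Type*} [Field F] [Fintype F] [DecidableEq κ] {p : ℕ}
    [CharP F p] (z : κ → F) (J : Finset κ) (hz : ∀ j ∈ J, z j ≠ 0) (hJ : J.card < p)
    (hp : p ≤ Fintype.card F) :
    (∑ I ∈ J.powerset, C ((-1 : F) ^ I.card) *
      (X + C (∑ i ∈ I, z i)) ^ (Fintype.card F - 1)).natDegree ≤ Fintype.card F - 1 - J.card ∧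
    (∑ I ∈ J.powerset, C ((-1 : F) ^ I.card) *
      (X + C (∑ i ∈ I, z i)) ^ (Fintype.card F - 1)).coeff (Fintype.card F - 1 - J.card) ≠ 0 := by
  induction J using Finset.induction_on with
  | empty => simp
  | insert j J hj ih =>
    rw [card_insert_of_notMem hj] at hJ ⊢
    have ih := ih (fun i hi => hz i (mem_insert_of_mem hi)) (by omega)
    set f := ∑ I ∈ J.powerset, C ((-1 : F) ^ I.card) *
      (X + C (∑ i ∈ I, z i)) ^ (Fintype.card F - 1) with hf
    have hstep : ∑ I ∈ (insert j J).powerset, C ((-1 : F) ^ I.card) *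
        (X + C (∑ i ∈ I, z i)) ^ (Fintype.card F - 1) = f - taylor (z j) f := by
      rw [sum_powerset_insert hj, sub_eq_add_neg]
      congr 1
      rw [hf, map_sum, ← sum_neg_distrib]
      refine sum_congr rfl fun I hI => ?_
      have hjI : j ∉ I := fun h => hj (mem_powerset.1 hI h)
      rw [card_insert_of_notMem hjI, sum_insert hjI, taylor_mul, taylor_pow, taylor_C, map_add C,
        map_add (taylor _), taylor_X, taylor_C, pow_succ]
      simp only [mul_neg, mul_one, C_neg, neg_mul]
      ring
    rw [hstep]
    have hsucc : Fintype.card F - 1 - J.card = Fintype.card F - 1 - (J.card + 1) + 1 := by omega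
    rw [hsucc] at ih
    refine natDegree_taylor_sub_le ih.1 ih.2 ?_ (hz j (mem_insert_self j J))
    rw [← hsucc]
    intro h
    have h2 : ((J.card + 1 : ℕ) : F) = 0 := by
      have : ((Fintype.card F - 1 - J.card + (J.card + 1) : ℕ) : F) = 0 := by
        rw [show Fintype.card F - 1 - J.card + (J.card + 1) = Fintype.card F by omega,
          FiniteField.cast_card_eq_zero]
      rwa [Nat.cast_add, h, zero_add] at this
    rw [CharP.cast_eq_zero_iff F p] at h2
    exact absurd (Nat.le_of_dvd (by omega) h2) (by omega)

theorem sum_eval_line_eq_zero {F σ : Type*} [Field F] [Fintype F] {Q : MvPolynomial σ F}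
    (hQ : Q.totalDegree < Fintype.card F - 1) (z e : σ → F) :
    ∑ c : F, MvPolynomial.eval (z + c • e) Q = 0 := by
  set g : Polynomial F :=
    MvPolynomial.aeval (fun i => Polynomial.C (z i) + Polynomial.C (e i) * Polynomial.X) Q with hg
  have hdeg : g.natDegree < Fintype.card F - 1 := by
    refine (MvPolynomial.aeval_natDegree_le (m := Q.totalDegree) (n := 1) Q le_rfl _ ?_).trans_lt
      (by rwa [mul_one])
    intro i
    compute_degree
  have heval : ∀ c, MvPolynomial.eval (z + c • e) Q = g.eval c := by
    intro c
    rw [hg]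
    generalize Q = R
    induction R using MvPolynomial.induction_on with
    | C a => simp
    | add R R' h h' => simp only [map_add, Polynomial.eval_add, h, h']
    | mul_X R i h => simp [h, mul_comm c]
  simp only [heval, Polynomial.eval_eq_sum_range]
  rw [sum_comm]
  refine sum_eq_zero fun i hi => ?_
  rw [← mul_sum, FiniteField.sum_pow_lt_card_sub_one F i (by rw [mem_range] at hi; omega), mul_zero]

/-- The value at `z` of the right-hand side of the defining equation of `P`. -/
def blockNumerator {F : Type} [Field F] (p q : ℕ) (hp : 0 < p) (z : Fin p → F) : F :=
  ∑ I : Finset (Fin (p - 1)), (-1 : F) ^ (I.card + 1) *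
    ((∑ i ∈ I, z (Fin.castLE (Nat.sub_le p 1) i)) +
      z (⟨p - 1, Nat.sub_lt hp one_pos⟩ : Fin p)) ^ (q - 1)

section Block

variable {F : Type} [Field F] {p q : ℕ} {P : MvPolynomial (Fin p) F}

theorem prod_mul_eval_eq_blockNumerator {hp : 0 < p} (hP : Pdef p q hp P) (z : Fin p → F) :
    (∏ i : Fin (p - 1), z (Fin.castLE (Nat.sub_le p 1) i)) * MvPolynomial.eval z P =
      blockNumerator p q hp z := by
  have := congrArg (MvPolynomial.eval z) hP
  simpa [blockNumerator, MvPolynomial.eval_prod] using this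

theorem exists_blockNumerator_ne_zero [Fintype F] [CharP F p] (hp : 0 < p)
    (hpF : p ≤ Fintype.card F) (z : Fin p → F)
    (hz : ∀ i : Fin (p - 1), z (Fin.castLE (Nat.sub_le p 1) i) ≠ 0) :
    ∃ y, blockNumerator p (Fintype.card F) hp
      (Function.update z ⟨p - 1, Nat.sub_lt hp one_pos⟩ y) ≠ 0 := by
  classical
  set u : Fin (p - 1) → F := fun i => z (Fin.castLE (Nat.sub_le p 1) i) with hu
  set g : Polynomial F := ∑ I : Finset (Fin (p - 1)), Polynomial.C ((-1 : F) ^ I.card) *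
    (Polynomial.X + Polynomial.C (∑ i ∈ I, u i)) ^ (Fintype.card F - 1) with hg
  have hmain := natDegree_sum_powerset_le (p := p) u univ (fun j _ => hz j)
    (by rw [card_univ, Fintype.card_fin]; omega) hpF
  rw [powerset_univ, ← hg] at hmain
  have hg0 : g ≠ 0 := fun h => hmain.2 (by rw [h, Polynomial.coeff_zero])
  by_contra! hall
  refine hg0 (Polynomial.eq_zero_of_natDegree_lt_card_of_eval_eq_zero g
    (Function.injective_id) (fun y => ?_) (by
      have := hmain.1
      have := Fintype.card_pos (α := F)
      omega))
  have hne : ∀ i : Fin (p - 1), Fin.castLE (Nat.sub_le p 1) i ≠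
      (⟨p - 1, Nat.sub_lt hp one_pos⟩ : Fin p) := fun i h => by
    have := congrArg Fin.val h
    simp at this
    omega
  have hy := hall y
  simp only [blockNumerator, Function.update_self, Function.update_of_ne (hne _), pow_succ,
    mul_neg, mul_one, neg_mul, sum_neg_distrib, neg_eq_zero] at hy
  rw [← hy, hg, Polynomial.eval_finsetSum]
  simp [hu, add_comm, Polynomial.eval_finsetSum]

theorem totalDegree_lt_of_Pdef {hp : 0 < p} (hp2 : 2 ≤ p) (hq : 2 ≤ q) (hP : Pdef p q hp P) :
    P.totalDegree < q - 1 ∨ P = 0 := by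
  by_cases h0 : P = 0
  · exact Or.inr h0
  left
  have hX : ∀ i : Fin p, (MvPolynomial.X i : MvPolynomial (Fin p) F) ≠ 0 :=
    fun i => MvPolynomial.X_ne_zero i
  have hprod : (∏ i : Fin (p - 1), MvPolynomial.X (Fin.castLE (Nat.sub_le p 1) i) :
      MvPolynomial (Fin p) F).totalDegree = p - 1 := by
    have : ∀ s : Finset (Fin (p - 1)), (∏ i ∈ s, MvPolynomial.X (Fin.castLE (Nat.sub_le p 1) i) :
        MvPolynomial (Fin p) F).totalDegree = s.card := by
      intro s
      induction s using Finset.induction_on with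
      | empty => simp
      | insert i s hi ih =>
        rw [prod_insert hi, MvPolynomial.totalDegree_mul_of_isDomain (hX _)
          (prod_ne_zero_iff.2 fun i _ => hX _), ih, MvPolynomial.totalDegree_X,
          card_insert_of_notMem hi, add_comm]
    rw [this, card_univ, Fintype.card_fin]
  have hdeg := congrArg MvPolynomial.totalDegree hP
  rw [MvPolynomial.totalDegree_mul_of_isDomain (prod_ne_zero_iff.2 fun i _ => hX _) h0, hprod]
    at hdeg
  have hle : (∑ I : Finset (Fin (p - 1)),
      MvPolynomial.C ((-1 : F) ^ (I.card + 1)) *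
        ((∑ i ∈ I, MvPolynomial.X (Fin.castLE (Nat.sub_le p 1) i)) +
          MvPolynomial.X (⟨p - 1, Nat.sub_lt hp one_pos⟩ : Fin p)) ^ (q - 1)).totalDegree ≤
      q - 1 := by
    refine MvPolynomial.totalDegree_finsetSum_le fun I _ => ?_
    refine (MvPolynomial.totalDegree_mul _ _).trans ?_
    rw [MvPolynomial.totalDegree_C, zero_add]
    refine (MvPolynomial.totalDegree_pow _ _).trans ?_
    refine (Nat.mul_le_mul_left _ ?_).trans_eq (mul_one _)
    refine (MvPolynomial.totalDegree_add _ _).trans (max_le ?_ ?_)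
    · exact MvPolynomial.totalDegree_finsetSum_le fun i _ => (MvPolynomial.totalDegree_X _).le
    · exact (MvPolynomial.totalDegree_X _).le
  omega

end Block

/-- A function obeying the exchange relation and vanishing line sums satisfied by `P` is a multiple
of `P`. -/
theorem exists_eq_mul_of_exchange {F κ : Type*} [Field F] [Fintype F] [Fintype κ] [DecidableEq κ]
    (L j₀ : κ) (hj₀ : j₀ ≠ L) {G Φ : (κ → F) → F}
    (hG : ∀ z, (∀ i ≠ L, z i ≠ 0) → ∃ y, G (Function.update z L y) ≠ 0)
    (hex : ∀ j ≠ L, ∀ z z', (∀ i ≠ L, z i ≠ 0) → (∀ i ≠ L, z' i ≠ 0) →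
      (∀ i, i ≠ j → i ≠ L → z i = z' i) → Φ z * G z' = Φ z' * G z)
    (hGsum : ∀ j ≠ L, ∀ z, ∑ c, G (Function.update z j c) = 0)
    (hΦsum : ∀ j ≠ L, ∀ z, ∑ c, Φ (Function.update z j c) = 0) :
    ∃ c, ∀ z, Φ z = c * G z := by
  classical
  obtain ⟨y₀, hy₀⟩ := hG (fun _ => 1) fun _ _ => one_ne_zero
  set o : κ → F := Function.update (fun _ => 1) L y₀ with ho
  have ho1 : ∀ i ≠ L, o i = 1 := fun i hi => by rw [ho, Function.update_of_ne hi]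
  have hgen : ∀ m z, (∀ i ≠ L, z i ≠ 0) → (univ.filter fun i => i ≠ L ∧ z i ≠ 1).card ≤ m →
      Φ z = Φ o / G o * G z := by
    intro m
    induction m with
    | zero =>
      intro z hz hm
      have hall : ∀ i ≠ L, z i = 1 := by
        intro i hi
        by_contra hne
        exact (card_pos.2 ⟨i, mem_filter.2 ⟨mem_univ _, hi, hne⟩⟩).ne' (Nat.le_zero.1 hm)
      have := hex j₀ hj₀ z o hz (fun i hi => by rw [ho1 i hi]; exact one_ne_zero)
        fun i _ hi => by rw [hall i hi, ho1 i hi]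
      field_simp
      exact this
    | succ m ih =>
      intro z hz hm
      by_cases hall : ∀ i ≠ L, z i = 1
      · refine ih z hz ?_
        rw [filter_eq_empty_iff.2 fun i _ h => h.2 (hall i h.1), card_empty]
        exact Nat.zero_le m
      · push Not at hall
        obtain ⟨j, hj, hzj⟩ := hall
        set w := Function.update z j 1 with hw
        have hw0 : ∀ i ≠ L, w i ≠ 0 := by
          intro i hi
          by_cases hij : i = j
          · subst hij; simp [hw]
          · rw [hw, Function.update_of_ne hij]; exact hz i hi
        obtain ⟨y, hy⟩ := hG w hw0
        set w' := Function.update w L y with hw'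
        have hw'w : ∀ i ≠ L, w' i = w i := fun i hi => by rw [hw', Function.update_of_ne hi]
        have hw'0 : ∀ i ≠ L, w' i ≠ 0 := fun i hi => by rw [hw'w i hi]; exact hw0 i hi
        have hlt : (univ.filter fun i => i ≠ L ∧ w' i ≠ 1) ⊂
            (univ.filter fun i => i ≠ L ∧ z i ≠ 1) := by
          rw [ssubset_iff_of_subset]
          · exact ⟨j, by simp [hj, hzj], by simp [hw'w j hj, hw]⟩
          · intro i hi
            simp only [mem_filter, mem_univ, true_and] at hi ⊢
            refine ⟨hi.1, ?_⟩
            have h2 := hi.2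
            rw [hw'w i hi.1] at h2
            by_cases hij : i = j
            · exact hij ▸ hzj
            · rwa [hw, Function.update_of_ne hij] at h2
        have hΦw := ih w' hw'0 (by have := card_lt_card hlt; omega)
        have := hex j hj z w' hz hw'0 fun i hij hi => by
          rw [hw'w i hi, hw, Function.update_of_ne hij]
        rw [hΦw] at this
        refine mul_right_cancel₀ hy (this.trans ?_)
        ring
  refine ⟨Φ o / G o, ?_⟩
  suffices h : ∀ m z, (univ.filter fun i => i ≠ L ∧ z i = 0).card ≤ m → Φ z = Φ o / G o * G z from
    fun z => h _ z le_rfl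
  intro m
  induction m with
  | zero =>
    intro z hm
    refine hgen _ z (fun i hi h0 => ?_) le_rfl
    exact (card_pos.2 ⟨i, mem_filter.2 ⟨mem_univ _, hi, h0⟩⟩).ne' (Nat.le_zero.1 hm)
  | succ m ih =>
    intro z hm
    by_cases hall : ∀ i ≠ L, z i ≠ 0
    · exact hgen _ z hall le_rfl
    · push Not at hall
      obtain ⟨j, hj, hzj⟩ := hall
      have hne : ∀ c ∈ (univ : Finset F).erase 0,
          Φ (Function.update z j c) = Φ o / G o * G (Function.update z j c) := by
        intro c hc
        refine ih _ ?_
        have hlt : (univ.filter fun i => i ≠ L ∧ Function.update z j c i = 0) ⊂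
            (univ.filter fun i => i ≠ L ∧ z i = 0) := by
          rw [ssubset_iff_of_subset]
          · exact ⟨j, by simp [hj, hzj], by simp [ne_of_mem_erase hc]⟩
          · intro i hi
            simp only [mem_filter, mem_univ, true_and] at hi ⊢
            refine ⟨hi.1, ?_⟩
            by_cases hij : i = j
            · exact hij ▸ hzj
            · rw [← hi.2, Function.update_of_ne hij]
        have := card_lt_card hlt
        omega
      have hz : Function.update z j 0 = z := by rw [← hzj, Function.update_eq_self]
      have h1 := hΦsum j hj z
      have h2 := hGsum j hj z
      rw [← add_sum_erase _ _ (mem_univ (0 : F)), hz] at h1 h2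
      rw [sum_congr rfl hne, ← mul_sum] at h1
      rw [eq_neg_of_add_eq_zero_left h1, eq_neg_of_add_eq_zero_left h2]
      ring

open scoped Classical in
theorem IsMultiplier.indicator_and_linearMap {F : Type} [Field F] [Fintype F] {ℓ : ℕ}
    (ξ ζ : (Fin ℓ → F) →ₗ[F] F) (c c' : F) :
    IsMultiplier (fun x => if ξ x + c = 0 ∧ ζ x + c' = 0 then (1 : F) else 0) := by
  have hdot : ∀ (ξ : (Fin ℓ → F) →ₗ[F] F) x, (fun i => ξ (Pi.single i 1)) ⬝ᵥ x = ξ x := by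
    intro ξ x
    conv_rhs => rw [← Finset.univ_sum_single x, map_sum]
    refine sum_congr rfl fun i _ => ?_
    have hx : Pi.single i (x i) = x i • (Pi.single i 1 : Fin ℓ → F) := by
      ext k
      simp [Pi.single_apply]
    rw [hx, map_smul, smul_eq_mul, mul_comm]
  convert indicator_and (fun i => ξ (Pi.single i 1)) (fun i => ζ (Pi.single i 1)) c c' using 5 <;>
    rw [hdot]

open scoped Classical in
theorem IsMultiplier.indicator_mul_blockNumerator {F : Type} [Field F] [Fintype F] {p ℓ : ℕ}
    (hp : 0 < p) (π : (Fin ℓ → F) →ₗ[F] (Fin p → F)) (j : Fin p) (α : F) (ε : Fin p → F) :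
    IsMultiplier (fun y => (if π y j = α then (1 : F) else 0) *
      blockNumerator p (Fintype.card F) hp (π y + ε)) := by
  have hsummand : ∀ I : Finset (Fin (p - 1)), IsMultiplier (fun y =>
      (-1 : F) ^ (I.card + 1) * ((if π y j = α then (1 : F) else 0) *
        ((∑ i ∈ I, (π y + ε) (Fin.castLE (Nat.sub_le p 1) i)) +
          (π y + ε) (⟨p - 1, Nat.sub_lt hp one_pos⟩ : Fin p)) ^ (Fintype.card F - 1))) := by
    intro I
    refine IsMultiplier.const_mul _ ?_
    let L : Fin p := ⟨p - 1, Nat.sub_lt hp one_pos⟩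
    let ξ : (Fin ℓ → F) →ₗ[F] F := LinearMap.proj j ∘ₗ π
    let ζ : (Fin ℓ → F) →ₗ[F] F :=
      (∑ i ∈ I, LinearMap.proj (Fin.castLE (Nat.sub_le p 1) i) + LinearMap.proj L) ∘ₗ π
    convert (indicator_and_linearMap ξ 0 (-α) 0).sub (indicator_and_linearMap ξ ζ (-α)
      ((∑ i ∈ I, ε (Fin.castLE (Nat.sub_le p 1) i)) + ε L)) using 2 with y
    have hζ : (∑ i ∈ I, (π y + ε) (Fin.castLE (Nat.sub_le p 1) i)) + (π y + ε) L =
        ζ y + ((∑ i ∈ I, ε (Fin.castLE (Nat.sub_le p 1) i)) + ε L) := by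
      simp only [ζ, LinearMap.comp_apply, LinearMap.add_apply, LinearMap.sum_apply,
        LinearMap.proj_apply, Pi.add_apply, sum_add_distrib]
      ring
    have hξ : ξ y + -α = 0 ↔ π y j = α := by
      rw [← sub_eq_add_neg, sub_eq_zero]
      rfl
    rw [hζ]
    simp only [hξ, LinearMap.zero_apply, add_zero, and_true]
    by_cases h1 : π y j = α
    · by_cases h2 : ζ y + ((∑ i ∈ I, ε (Fin.castLE (Nat.sub_le p 1) i)) + ε L) = 0
      · have hq : Fintype.card F - 1 ≠ 0 := by
          have := Fintype.one_lt_card (α := F)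
          omega
        simp [h1, h2, hq]
      · simp [h1, h2, FiniteField.pow_card_sub_one_eq_one _ h2]
    · simp [h1]
  convert IsMultiplier.sum univ fun I _ => hsummand I using 2 with y
  rw [blockNumerator, mul_sum]
  exact sum_congr rfl fun I _ => by ring

/-- The `i`-th block of `p` consecutive coordinates. -/
def blockMap {F : Type} [Field F] (p i : ℕ) {ℓ : ℕ} : (Fin ℓ → F) →ₗ[F] (Fin p → F) where
  toFun x l := if h : p * i + (l : ℕ) < ℓ then x ⟨p * i + (l : ℕ), h⟩ else 0
  map_add' x y := by
    ext l
    by_cases h : p * i + (l : ℕ) < ℓ <;> simp [h]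
  map_smul' c x := by
    ext l
    by_cases h : p * i + (l : ℕ) < ℓ <;> simp [h]

/-- The vector whose `i`-th block is `z` and whose other coordinates vanish. -/
def blockEmbed {F : Type} [Field F] {p : ℕ} (i ℓ : ℕ) : (Fin p → F) →ₗ[F] (Fin ℓ → F) where
  toFun z m := if h : p * i ≤ m ∧ (m : ℕ) < p * i + p then z ⟨m - p * i, by omega⟩ else 0
  map_add' x y := by
    ext m
    by_cases h : p * i ≤ m ∧ (m : ℕ) < p * i + p <;> simp [h]
  map_smul' c x := by
    ext m
    by_cases h : p * i ≤ m ∧ (m : ℕ) < p * i + p <;> simp [h]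

section BlockMap

variable {F : Type} [Field F] {p i ℓ : ℕ}

theorem blockMap_blockEmbed (h : p * i + p ≤ ℓ) (z : Fin p → F) :
    blockMap p i (blockEmbed i ℓ z) = z := by
  ext l
  have := l.2
  simp only [blockMap, blockEmbed, LinearMap.coe_mk, AddHom.coe_mk]
  rw [dif_pos (by omega), dif_pos (by omega)]
  congr
  simp

theorem blockMap_blockEmbed_of_ne {i' : ℕ} (hi : i' ≠ i) (z : Fin p → F) :
    blockMap p i' (blockEmbed i ℓ z) = 0 := by
  ext l
  have hl := l.2
  simp only [blockMap, blockEmbed, LinearMap.coe_mk, AddHom.coe_mk, Pi.zero_apply]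
  split_ifs with h1 h2
  · exfalso
    rcases lt_or_gt_of_ne hi with h | h
    · have : p * (i' + 1) ≤ p * i := Nat.mul_le_mul_left p h
      rw [mul_add] at this
      omega
    · have : p * (i + 1) ≤ p * i' := Nat.mul_le_mul_left p h
      rw [mul_add] at this
      omega
  · rfl
  · rfl

theorem blockEmbed_natAdd {s t : ℕ} (h : p * i + p ≤ s) (z : Fin p → F) (j : Fin t) :
    blockEmbed i (s + t) z (Fin.natAdd s j) = 0 := by
  simp only [blockEmbed, LinearMap.coe_mk, AddHom.coe_mk, Fin.val_natAdd]
  rw [dif_neg (by omega)]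

theorem blockMap_single_natAdd {s t : ℕ} (h : p * i + p ≤ s) (c : F) (j : Fin t) :
    blockMap p i (Pi.single (Fin.natAdd s j) c) = 0 := by
  ext l
  have hl := l.2
  simp only [blockMap, LinearMap.coe_mk, AddHom.coe_mk, Pi.zero_apply]
  rw [dif_pos (by omega), Pi.single_eq_of_ne]
  intro heq
  have := congrArg Fin.val heq
  simp only [Fin.val_natAdd] at this
  omega

theorem mul_add_le_of_lt_div {s : ℕ} (hi : i < s / p) : p * i + p ≤ s := by
  calc p * i + p = p * (i + 1) := by ring
    _ ≤ p * (s / p) := Nat.mul_le_mul_left p hi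
    _ ≤ s := Nat.mul_div_le s p

theorem ext_of_blockMap_eq {s t : ℕ} (hp : 0 < p) (hs : p ∣ s) {x y : Fin (s + t) → F}
    (hblock : ∀ i < s / p, blockMap p i x = blockMap p i y)
    (hlast : ∀ j : Fin t, x (Fin.natAdd s j) = y (Fin.natAdd s j)) : x = y := by
  ext m
  refine Fin.addCases (fun m => ?_) (fun j => hlast j) m
  have hm : (m : ℕ) / p < s / p := Nat.div_lt_div_of_lt_of_dvd hs m.2
  have := congrFun (hblock _ hm) ⟨m % p, Nat.mod_lt _ hp⟩
  simp only [blockMap, LinearMap.coe_mk, AddHom.coe_mk] at this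
  have hmod := Nat.div_add_mod (m : ℕ) p
  have hlt : p * ((m : ℕ) / p) + (m : ℕ) % p < s + t := by have := m.2; omega
  rw [dif_pos hlt, dif_pos hlt] at this
  convert this using 2 <;> exact Fin.ext hmod.symm

theorem Hfun_eq (P : MvPolynomial (Fin p) F) (s t : ℕ) (e : Fin t → ℕ) (x : Fin (s + t) → F) :
    Hfun P s t e x = (∏ i ∈ range (s / p), MvPolynomial.eval (blockMap p i x) P) *
      ∏ j : Fin t, x (Fin.natAdd s j) ^ e j :=
  rfl

theorem Hfun_add_blockEmbed (P : MvPolynomial (Fin p) F) {s t : ℕ} (e : Fin t → ℕ)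
    (hi : i < s / p) (x : Fin (s + t) → F) (δ : Fin p → F) :
    Hfun P s t e (x + blockEmbed i (s + t) δ) =
      MvPolynomial.eval (blockMap p i x + δ) P *
        ((∏ i' ∈ (range (s / p)).erase i, MvPolynomial.eval (blockMap p i' x) P) *
          ∏ j : Fin t, x (Fin.natAdd s j) ^ e j) := by
  have hle := mul_add_le_of_lt_div hi
  rw [Hfun_eq, ← mul_prod_erase _ _ (mem_range.2 hi), map_add,
    blockMap_blockEmbed (by omega), mul_assoc]
  congr 2
  · refine prod_congr rfl fun i' hi' => ?_
    rw [map_add, blockMap_blockEmbed_of_ne (ne_of_mem_erase hi'), add_zero]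
  · refine prod_congr rfl fun j _ => ?_
    rw [Pi.add_apply, blockEmbed_natAdd hle, add_zero]

theorem Hfun_eq_eval_mul (P : MvPolynomial (Fin p) F) {s t : ℕ} (e : Fin t → ℕ)
    (hi : i < s / p) (x : Fin (s + t) → F) :
    Hfun P s t e x = MvPolynomial.eval (blockMap p i x) P *
        ((∏ i' ∈ (range (s / p)).erase i, MvPolynomial.eval (blockMap p i' x) P) *
          ∏ j : Fin t, x (Fin.natAdd s j) ^ e j) := by
  simpa using Hfun_add_blockEmbed P e hi x 0

theorem Hfun_add_single (P : MvPolynomial (Fin p) F) {s t : ℕ} (e : Fin t → ℕ) (j : Fin t)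
    (x : Fin (s + t) → F) (c : F) :
    x (Fin.natAdd s j) ^ e j *
      Hfun P s t (Function.update e j 0) (x + Pi.single (Fin.natAdd s j) c) = Hfun P s t e x := by
  rw [Hfun_eq, Hfun_eq, ← mul_prod_erase univ _ (mem_univ j),
    ← mul_prod_erase univ (fun j => x (Fin.natAdd s j) ^ e j) (mem_univ j), Function.update_self,
    pow_zero, one_mul, mul_left_comm]
  congr 1
  · refine prod_congr rfl fun i hi => ?_
    rw [map_add, blockMap_single_natAdd (mul_add_le_of_lt_div (mem_range.1 hi)), add_zero]
  · congr 1
    refine prod_congr rfl fun j' hj' => ?_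
    have hne := ne_of_mem_erase hj'
    rw [Function.update_of_ne hne, Pi.add_apply, Pi.single_eq_of_ne, add_zero]
    exact fun h => hne (Fin.natAdd_injective _ _ h)

/-- The exchange relation satisfied by `P`. -/
theorem mul_blockNumerator_mul_eval {q : ℕ} {P : MvPolynomial (Fin p) F} {hp : 0 < p}
    (hP : Pdef p q hp P) {j : Fin (p - 1)} {z z' : Fin p → F}
    (h : ∀ i : Fin (p - 1), i ≠ j →
      z (Fin.castLE (Nat.sub_le p 1) i) = z' (Fin.castLE (Nat.sub_le p 1) i)) :
    z (Fin.castLE (Nat.sub_le p 1) j) * blockNumerator p q hp z' * MvPolynomial.eval z P =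
      z' (Fin.castLE (Nat.sub_le p 1) j) * blockNumerator p q hp z * MvPolynomial.eval z' P := by
  rw [← prod_mul_eval_eq_blockNumerator hP, ← prod_mul_eval_eq_blockNumerator hP,
    ← mul_prod_erase univ _ (mem_univ j), ← mul_prod_erase univ (fun i => z _) (mem_univ j),
    prod_congr rfl fun i hi => (h i (ne_of_mem_erase hi)).symm]
  ring

end BlockMap

/-- The test functions `H_e` with `e` valid. -/
def validHfun {F : Type} [Field F] {p : ℕ} (P : MvPolynomial (Fin p) F) (q r s t : ℕ)
    (e : {e : Fin t → ℕ // validE q r t e}) : (Fin (s + t) → F) → F :=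
  Hfun P s t e.1

theorem validE.update_zero {q r t : ℕ} {e : Fin t → ℕ} (he : validE q r t e) (j : Fin t) :
    validE q r t (Function.update e j 0) := by
  have hle : ∀ j', Function.update e j 0 j' ≤ e j' := by
    intro j'
    by_cases h : j' = j
    · subst h
      simp
    · simp [h]
  exact ⟨fun j' => (hle j').trans (he.1 j'), (sum_le_sum fun j' _ => hle j').trans he.2⟩

theorem validE_zero (q r t : ℕ) : validE q r t 0 :=
  ⟨fun _ => Nat.zero_le _, by simp⟩

section Chain

variable {F : Type} [Field F] [Fintype F] {p n r s t : ℕ} {P : MvPolynomial (Fin p) F} {hp : 0 < p}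
  {f : (Fin n → F) → F} {b : Fin n → F} {η : ℝ}
  {v : (Fin (s + t) → F) → {e : Fin t → ℕ // validE (Fintype.card F) r t e} → F}

local notation "𝓗" => validHfun P (Fintype.card F) r s t

theorem IsTypicalValue.add_single_ne_zero (hv : IsTypicalValue f 𝓗 b η v)
    (hη : DensityBound f 𝓗 η) (hη6 : 6 * η < 1) {x : Fin (s + t) → F}
    {e : {e : Fin t → ℕ // validE (Fintype.card F) r t e}} (hx : v x e ≠ 0) (j : Fin t) (c : F) :
    v (x + Pi.single (Fin.natAdd s j) c) ⟨Function.update e.1 j 0, e.2.update_zero j⟩ ≠ 0 := by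
  classical
  set a := x (Fin.natAdd s j) with ha
  have hA : IsMultiplier (fun y : Fin (s + t) → F =>
      if y (Fin.natAdd s j) = a then (1 : F) else 0) := by
    convert IsMultiplier.indicator_and_linearMap
      (LinearMap.proj (Fin.natAdd s j) : (Fin (s + t) → F) →ₗ[F] F) 0 (-a) 0 using 3 with y
    simp [add_neg_eq_zero]
  have := hv.transfer hη hη6 hA (hA.const_mul (a ^ e.1 j)) (Pi.single (Fin.natAdd s j) c)
    (i := e) (j := ⟨Function.update e.1 j 0, e.2.update_zero j⟩) (fun y => ?_) x
  · intro h0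
    rw [h0, mul_zero, if_pos ha.symm, one_mul] at this
    exact hx this
  · by_cases hy : y (Fin.natAdd s j) = a
    · simp only [hy, if_true, one_mul, mul_one]
      rw [validHfun, validHfun, ← Hfun_add_single P e.1 j y c, hy]
    · simp [hy]

theorem IsTypicalValue.exists_natAdd_eq (hv : IsTypicalValue f 𝓗 b η v)
    (hη : DensityBound f 𝓗 η) (hη6 : 6 * η < 1) {a : Fin (s + t) → F} (ha : v a ≠ 0)
    (w : Fin (s + t) → F) :
    ∃ x, v x ⟨0, validE_zero _ r t⟩ ≠ 0 ∧ (∀ i < s / p, blockMap p i x = blockMap p i a) ∧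
      ∀ j, x (Fin.natAdd s j) = w (Fin.natAdd s j) := by
  classical
  have key : ∀ J : Finset (Fin t), ∃ x e, v x e ≠ 0 ∧
      (∀ i < s / p, blockMap p i x = blockMap p i a) ∧
      ∀ j ∈ J, x (Fin.natAdd s j) = w (Fin.natAdd s j) ∧ e.1 j = 0 := by
    intro J
    induction J using Finset.induction_on with
    | empty =>
      obtain ⟨e, he⟩ := Function.ne_iff.1 ha
      exact ⟨a, e, he, fun _ _ => rfl, by simp⟩
    | insert j J hj ih =>
      obtain ⟨x, e, hxe, hblock, hJ⟩ := ih
      refine ⟨_, _, hv.add_single_ne_zero hη hη6 hxe j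
        (w (Fin.natAdd s j) - x (Fin.natAdd s j)), fun i hi => ?_, fun j' hj' => ?_⟩
      · rw [map_add, blockMap_single_natAdd (mul_add_le_of_lt_div hi), add_zero, hblock i hi]
      · rcases eq_or_ne j' j with rfl | hne
        · simp
        · have hne' : Fin.natAdd s j' ≠ Fin.natAdd s j :=
            fun h => hne (Fin.natAdd_injective _ _ h)
          simpa [hne, hne'] using hJ j' (mem_of_mem_insert_of_ne hj' hne)
  obtain ⟨x, e, hxe, hblock, hlast⟩ := key univ
  have he : e = ⟨0, validE_zero _ r t⟩ := Subtype.ext (funext fun j => (hlast j (mem_univ j)).2)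
  exact ⟨x, he ▸ hxe, hblock, fun j => (hlast j (mem_univ j)).1⟩

theorem IsTypicalValue.exchange (hv : IsTypicalValue f 𝓗 b η v)
    (hη : DensityBound f 𝓗 η) (hη6 : 6 * η < 1) (hP : Pdef p (Fintype.card F) hp P) {i : ℕ}
    (hi : i < s / p) (x : Fin (s + t) → F)
    (e : {e : Fin t → ℕ // validE (Fintype.card F) r t e}) {j : Fin (p - 1)} (z' : Fin p → F)
    (h : ∀ i' : Fin (p - 1), i' ≠ j → blockMap p i x (Fin.castLE (Nat.sub_le p 1) i') =
      z' (Fin.castLE (Nat.sub_le p 1) i')) :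
    blockMap p i x (Fin.castLE (Nat.sub_le p 1) j) * blockNumerator p (Fintype.card F) hp z' *
        v x e =
      z' (Fin.castLE (Nat.sub_le p 1) j) *
        blockNumerator p (Fintype.card F) hp (blockMap p i x) *
        v (x + blockEmbed i (s + t) (z' - blockMap p i x)) e := by
  classical
  set z : Fin p → F := blockMap p i x with hz
  have hA := IsMultiplier.indicator_mul_blockNumerator hp
    (blockMap p i : (Fin (s + t) → F) →ₗ[F] _) (Fin.castLE (Nat.sub_le p 1) j)
    (z (Fin.castLE (Nat.sub_le p 1) j)) (z' - z)
  have hB := IsMultiplier.indicator_mul_blockNumerator hp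
    (blockMap p i : (Fin (s + t) → F) →ₗ[F] _) (Fin.castLE (Nat.sub_le p 1) j)
    (z (Fin.castLE (Nat.sub_le p 1) j)) 0
  have := hv.transfer hη hη6 (hA.const_mul (z (Fin.castLE (Nat.sub_le p 1) j)))
    (hB.const_mul (z' (Fin.castLE (Nat.sub_le p 1) j))) (blockEmbed i (s + t) (z' - z))
    (i := e) (j := e) (fun y => ?_) x
  · simpa [← hz] using this
  · by_cases hy : blockMap p i y (Fin.castLE (Nat.sub_le p 1) j) =
      z (Fin.castLE (Nat.sub_le p 1) j)
    · have hex := mul_blockNumerator_mul_eval hP (j := j) (z := blockMap p i y)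
        (z' := blockMap p i y + (z' - z)) fun i' hi' => by simp [h i' hi']
      simp only [hy, Pi.add_apply, Pi.sub_apply, add_sub_cancel] at hex
      rw [validHfun, Hfun_eq_eval_mul P e.1 hi y, Hfun_add_blockEmbed P e.1 hi]
      simp only [hy, if_true, one_mul, add_zero, ← mul_assoc, hex]
    · simp [hy]

theorem IsTypicalValue.exists_eq_mul_eval [CharP F p] (hv : IsTypicalValue f 𝓗 b η v)
    (hη : DensityBound f 𝓗 η) (hη6 : 6 * η < 1) (hηF : 2 * η * Fintype.card F < 1)
    (hP : Pdef p (Fintype.card F) hp P) (hp2 : 2 ≤ p) (hpF : p ≤ Fintype.card F)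
    (hdeg : P.totalDegree < Fintype.card F - 1) {i : ℕ}
    (hi : i < s / p) (x : Fin (s + t) → F)
    (e : {e : Fin t → ℕ // validE (Fintype.card F) r t e}) :
    ∃ c, ∀ z, v (x + blockEmbed i (s + t) (z - blockMap p i x)) e =
      c * MvPolynomial.eval z P := by
  classical
  have hsp := mul_add_le_of_lt_div hi
  have hne : ∀ i' : Fin (p - 1),
      Fin.castLE (Nat.sub_le p 1) i' ≠ (⟨p - 1, Nat.sub_lt hp one_pos⟩ : Fin p) := by
    intro i' h
    have := congrArg Fin.val h
    have := i'.2
    simp only [Fin.val_castLE] at *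
    omega
  have hcast : ∀ j : Fin p, j ≠ ⟨p - 1, Nat.sub_lt hp one_pos⟩ →
      ∃ j' : Fin (p - 1), j = Fin.castLE (Nat.sub_le p 1) j' := by
    intro j hj
    have h1 := j.2
    have h2 : (j : ℕ) ≠ p - 1 := fun h => hj (Fin.ext h)
    exact ⟨⟨j, by omega⟩, rfl⟩
  have hline : ∀ (z : Fin p → F) j c,
      Function.update z j c = Function.update z j 0 + c • Pi.single j 1 := by
    intro z j c
    ext l
    by_cases hl : l = j
    · subst hl
      simp
    · simp [hl]
  refine exists_eq_mul_of_exchange ⟨p - 1, Nat.sub_lt hp one_pos⟩ ⟨0, hp⟩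
    (fun h => by
      have : 0 = p - 1 := Fin.ext_iff.1 h
      omega)
    (fun z hz => ?_) (fun j hj z z' hz hz' hzz' => ?_) (fun j _ z => ?_) (fun j _ z => ?_)
  · obtain ⟨y, hy⟩ := exists_blockNumerator_ne_zero hp hpF z fun i' => hz _ (hne i')
    refine ⟨y, fun h0 => hy ?_⟩
    rw [← prod_mul_eval_eq_blockNumerator hP, h0, mul_zero]
  · obtain ⟨j', rfl⟩ := hcast j hj
    have hblock : blockMap p i (x + blockEmbed i (s + t) (z - blockMap p i x)) = z := by
      rw [map_add, blockMap_blockEmbed (by omega), add_sub_cancel]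
    have := hv.exchange hη hη6 hP hi (x + blockEmbed i (s + t) (z - blockMap p i x)) e (j := j') z'
      fun i' hi' => by
        rw [hblock]
        exact hzz' _ (fun h => hi' (Fin.castLE_injective _ h)) (hne i')
    have hshift : x + blockEmbed i (s + t) (z - blockMap p i x) + blockEmbed i (s + t) (z' - z) =
        x + blockEmbed i (s + t) (z' - blockMap p i x) := by
      rw [add_assoc, ← map_add, sub_add_sub_cancel']
    rw [hblock, hshift, ← prod_mul_eval_eq_blockNumerator hP, ← prod_mul_eval_eq_blockNumerator hP,
      ← mul_prod_erase univ _ (mem_univ j'), ← mul_prod_erase univ (fun i => z _) (mem_univ j'),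
      prod_congr rfl fun i' hi' =>
        hzz' _ (fun h => ne_of_mem_erase hi' (Fin.castLE_injective _ h)) (hne i')] at this
    have hR : z (Fin.castLE (Nat.sub_le p 1) j') * z' (Fin.castLE (Nat.sub_le p 1) j') *
        ∏ i' ∈ univ.erase j', z' (Fin.castLE (Nat.sub_le p 1) i') ≠ 0 :=
      mul_ne_zero (mul_ne_zero (hz _ (hne _)) (hz' _ (hne _)))
        (prod_ne_zero_iff.2 fun i' _ => hz' _ (hne i'))
    refine mul_left_cancel₀ hR ?_
    linear_combination this
  · exact (sum_congr rfl fun c _ => congrArg (MvPolynomial.eval · P) (hline z j c)).trans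
      (sum_eval_line_eq_zero hdeg _ _)
  · have hX : ∀ c : F, x + blockEmbed i (s + t) (Function.update z j c - blockMap p i x) =
        x + blockEmbed i (s + t) (Function.update z j 0 - blockMap p i x) +
          c • blockEmbed i (s + t) (Pi.single j 1) := by
      intro c
      rw [hline z j c, add_assoc, ← map_smul, ← map_add, add_sub_right_comm]
    refine (sum_congr rfl fun c _ => congrArg (v · e) (hX c)).trans
      (hv.sum_line_eq_zero hηF (fun y => ?_) _)
    simp only [validHfun, ← map_smul, Hfun_add_blockEmbed P e.1 hi]
    rw [← sum_mul, sum_eval_line_eq_zero hdeg, zero_mul]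

theorem eval_blockMap_ne_zero {q : ℕ} {w : Fin (s + t) → F} (hw : w ∈ suppH P q s t) {i : ℕ}
    (hi : i < s / p) : MvPolynomial.eval (blockMap p i w) P ≠ 0 := by
  obtain ⟨e, -, he⟩ := hw
  rw [Hfun_eq] at he
  exact prod_ne_zero_iff.1 (left_ne_zero_of_mul he) i (mem_range.2 hi)

theorem IsTypicalValue.ne_zero_of_mem_suppH [CharP F p] (hv : IsTypicalValue f 𝓗 b η v)
    (hη : DensityBound f 𝓗 η) (hη6 : 6 * η < 1) (hηF : 2 * η * Fintype.card F < 1)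
    (hP : Pdef p (Fintype.card F) hp P) (hp2 : 2 ≤ p) (hpF : p ≤ Fintype.card F) (hps : p ∣ s)
    {a w : Fin (s + t) → F} (ha : v a ≠ 0)
    (hw : w ∈ suppH P (Fintype.card F) s t) : v w ≠ 0 := by
  obtain ⟨x₀, hx₀, hblock₀, hlast₀⟩ := hv.exists_natAdd_eq hη hη6 ha w
  have key : ∀ k ≤ s / p, ∃ x, v x ⟨0, validE_zero _ r t⟩ ≠ 0 ∧
      (∀ i < k, blockMap p i x = blockMap p i w) ∧
      ∀ j, x (Fin.natAdd s j) = w (Fin.natAdd s j) := by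
    intro k
    induction k with
    | zero => exact fun _ => ⟨x₀, hx₀, by simp, hlast₀⟩
    | succ k ih =>
      intro hk
      obtain ⟨x, hx, hblock, hlast⟩ := ih (by omega)
      have hsp := mul_add_le_of_lt_div hk
      have hwk := eval_blockMap_ne_zero hw hk
      have hdeg : P.totalDegree < Fintype.card F - 1 := by
        refine (totalDegree_lt_of_Pdef hp2 (hp2.trans hpF) hP).resolve_right fun h0 => hwk ?_
        rw [h0, map_zero]
      obtain ⟨c, hc⟩ := hv.exists_eq_mul_eval hη hη6 hηF hP hp2 hpF hdeg hk x
        ⟨0, validE_zero _ r t⟩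
      have hc0 : c ≠ 0 := by
        rintro rfl
        have := hc (blockMap p k x)
        rw [sub_self, map_zero, add_zero, zero_mul] at this
        exact hx this
      refine ⟨_, (hc (blockMap p k w)).trans_ne (mul_ne_zero hc0 hwk), fun i hi => ?_,
        fun j => ?_⟩
      · rw [map_add]
        rcases Nat.lt_succ_iff_lt_or_eq.1 hi with hik | rfl
        · rw [blockMap_blockEmbed_of_ne hik.ne, add_zero, hblock i hik]
        · rw [blockMap_blockEmbed (by omega), add_sub_cancel]
      · rw [Pi.add_apply, blockEmbed_natAdd hsp, add_zero, hlast]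
  obtain ⟨x, hx, hblock, hlast⟩ := key _ le_rfl
  rw [ext_of_blockMap_eq hp hps hblock hlast] at hx
  exact fun h => hx (congrFun h _)

end Chain

section Counting

variable {F : Type} [Field F] [Fintype F] {n ℓ : ℕ}

theorem natCard_eq_card_filter_mem {α : Type*} [Fintype α] (A : Set α) [DecidablePred (· ∈ A)] :
    Nat.card ↥A = (univ.filter (· ∈ A)).card := by
  rw [Nat.card_eq_fintype_card, Fintype.card_subtype]

open scoped Classical in
theorem natCard_inter_affApp_eq (R : Set (Aff F n ℓ)) (a : Fin ℓ → F) (b : Fin n → F) :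
    Nat.card ↥(R ∩ {T : Aff F n ℓ | affApp T a = b}) =
      (univ.filter fun M => affThrough b a M ∈ R).card := by
  rw [natCard_eq_card_filter_mem]
  symm
  refine card_bij (fun M _ => affThrough b a M) (fun M hM => ?_) (fun M _ M' _ h => ?_)
    (fun T hT => ?_)
  · simpa [affApp_affThrough] using hM
  · exact congrArg Prod.fst h
  · simp only [mem_filter, mem_univ, true_and, Set.mem_inter_iff, Set.mem_ofPred_eq] at hT
    have h := eq_affThrough_affApp T a
    rw [hT.2] at h
    exact ⟨T.1, by simpa [← h] using hT.1, h.symm⟩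

open scoped Classical in
theorem two_mul_card_not_injective_le (h : ℓ + 1 ≤ n) :
    2 * (univ.filter fun M : Matrix (Fin n) (Fin ℓ) F =>
      ¬ Function.Injective M.mulVec).card ≤ Fintype.card (Matrix (Fin n) (Fin ℓ) F) := by
  have hsub : (univ.filter fun M : Matrix (Fin n) (Fin ℓ) F => ¬ Function.Injective M.mulVec) ⊆
      (univ.filter fun x : Fin ℓ → F => x ≠ 0).biUnion fun x =>
        univ.filter fun M => M.mulVec x = 0 := by
    intro M hM
    have hM' := (mem_filter.1 hM).2
    simp only [Function.Injective] at hM'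
    push Not at hM'
    obtain ⟨x, y, hxy, hne⟩ := hM'
    simp only [mem_biUnion, mem_filter, mem_univ, true_and]
    exact ⟨x - y, sub_ne_zero.2 hne, by rw [Matrix.mulVec_sub, hxy, sub_self]⟩
  have hker : ∀ x : Fin ℓ → F, x ≠ 0 →
      (univ.filter fun M : Matrix (Fin n) (Fin ℓ) F => M.mulVec x = 0).card *
        Fintype.card (Fin n → F) = Fintype.card (Matrix (Fin n) (Fin ℓ) F) := by
    intro x hx
    obtain ⟨i, hi⟩ := Function.ne_iff.1 hx
    have := card_filter_comp_mul_card
      (AddMonoidHom.mk' (fun M : Matrix (Fin n) (Fin ℓ) F => M.mulVec x) fun M M' =>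
        Matrix.add_mulVec M M' x)
      (fun y => ⟨Matrix.vecMulVec y (Pi.single i (x i)⁻¹), by
        simp [Matrix.vecMulVec_mulVec, inv_mul_cancel₀ hi]⟩) (· = 0)
    have hone : (univ.filter fun y : Fin n → F => y = 0).card = 1 :=
      card_eq_one.2 ⟨0, by ext; simp⟩
    rw [← one_mul (Fintype.card (Matrix (Fin n) (Fin ℓ) F)), ← hone]
    convert this
    rfl
  have hle : (univ.filter fun M : Matrix (Fin n) (Fin ℓ) F =>
        ¬ Function.Injective M.mulVec).card * Fintype.card (Fin n → F) ≤
      Fintype.card (Fin ℓ → F) * Fintype.card (Matrix (Fin n) (Fin ℓ) F) := by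
    refine (Nat.mul_le_mul_right _ ((card_le_card hsub).trans card_biUnion_le)).trans ?_
    rw [sum_mul, sum_congr rfl fun x hx => hker x (mem_filter.1 hx).2, sum_const, smul_eq_mul]
    exact Nat.mul_le_mul_right _ (card_le_univ _)
  have hpow : 2 * Fintype.card (Fin ℓ → F) ≤ Fintype.card (Fin n → F) := by
    simp only [Fintype.card_fun, Fintype.card_fin]
    calc 2 * Fintype.card F ^ ℓ ≤ Fintype.card F * Fintype.card F ^ ℓ :=
          Nat.mul_le_mul_right _ Fintype.one_lt_card
      _ = Fintype.card F ^ (ℓ + 1) := by ring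
      _ ≤ Fintype.card F ^ n := Nat.pow_le_pow_right Fintype.card_pos h
  have hpos : 0 < Fintype.card (Fin n → F) := Fintype.card_pos
  refine Nat.le_of_mul_le_mul_right ?_ hpos
  calc _ = 2 * ((univ.filter fun M : Matrix (Fin n) (Fin ℓ) F =>
        ¬ Function.Injective M.mulVec).card * Fintype.card (Fin n → F)) := by ring
    _ ≤ 2 * (Fintype.card (Fin ℓ → F) * Fintype.card (Matrix (Fin n) (Fin ℓ) F)) :=
        Nat.mul_le_mul_left _ hle
    _ = 2 * Fintype.card (Fin ℓ → F) * Fintype.card (Matrix (Fin n) (Fin ℓ) F) := by ring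
    _ ≤ Fintype.card (Fin n → F) * Fintype.card (Matrix (Fin n) (Fin ℓ) F) :=
        Nat.mul_le_mul_right _ hpow
    _ = _ := mul_comm _ _

open scoped Classical in
theorem one_sub_two_mul_le_dens_union (h : ℓ + 1 ≤ n) {R : Set (Aff F n ℓ)} {K : Set (Fin ℓ → F)}
    (hK : K.Nonempty) {b : Fin n → F} {ε : ℝ}
    (hε : ∀ w ∈ K, ((univ.filter fun M => affThrough b w M ∉ R).card : ℝ) ≤
      ε * Fintype.card (Matrix (Fin n) (Fin ℓ) F)) :
    1 - 2 * ε ≤ _root_.dens R {T : Aff F n ℓ | ∃ w ∈ K, affApp T w = b} := by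
  set U : Set (Aff F n ℓ) := {T | ∃ w ∈ K, affApp T w = b} with hU
  set k : Finset (Fin ℓ → F) := univ.filter (· ∈ K) with hk
  set J : Finset (Matrix (Fin n) (Fin ℓ) F) :=
    univ.filter fun M => Function.Injective M.mulVec with hJ
  set N : ℕ := Fintype.card (Matrix (Fin n) (Fin ℓ) F) with hN
  have hNpos : (0 : ℝ) < N := Nat.cast_pos.2 Fintype.card_pos
  have hkpos : (0 : ℝ) < k.card := by
    obtain ⟨w, hw⟩ := hK
    exact Nat.cast_pos.2 (card_pos.2 ⟨w, by simpa [hk] using hw⟩)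
  have hε0 : 0 ≤ ε := by
    obtain ⟨w, hw⟩ := hK
    exact nonneg_of_mul_nonneg_left ((Nat.cast_nonneg _).trans (hε w hw)) hNpos
  have hJcard : (N : ℝ) ≤ 2 * J.card := by
    have h1 := two_mul_card_not_injective_le (F := F) h
    have h2 : J.card + (univ.filter fun M : Matrix (Fin n) (Fin ℓ) F =>
        ¬ Function.Injective M.mulVec).card = N := by
      rw [hN, ← card_univ]
      exact card_filter_add_card_filter_not _
    have : N ≤ 2 * J.card := by omega
    exact_mod_cast this
  have hUcard : k.card * J.card ≤ (univ.filter (· ∈ U)).card := by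
    rw [← card_product]
    refine card_le_card_of_injOn (fun z => affThrough b z.1 z.2) (fun z hz => ?_) ?_
    · simp only [coe_product, Set.mem_prod, mem_coe, hk, mem_filter, mem_univ, true_and] at hz
      simp only [mem_coe, mem_filter, mem_univ, true_and, hU, Set.mem_ofPred_eq]
      exact ⟨z.1, hz.1, by simp [affApp_affThrough]⟩
    · rintro ⟨w, M⟩ hz ⟨w', M'⟩ - heq
      simp only [coe_product, Set.mem_prod, mem_coe, hJ, mem_filter, mem_univ, true_and] at hz
      obtain ⟨h1, h2⟩ := Prod.ext_iff.1 heq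
      simp only [affThrough] at h1 h2
      subst h1
      rw [hz.2 (sub_right_injective h2)]
  have hdiff : ((univ.filter (· ∈ U \ R)).card : ℝ) ≤ k.card * (ε * N) := by
    have hsub : univ.filter (· ∈ U \ R) ⊆ k.biUnion fun w =>
        (univ.filter fun M => affThrough b w M ∉ R).image (affThrough b w) := by
      intro T hT
      simp only [mem_filter, mem_univ, true_and, Set.mem_sdiff, hU, Set.mem_ofPred_eq] at hT
      obtain ⟨⟨w, hw, hTw⟩, hTR⟩ := hT
      have hT := eq_affThrough_affApp T w
      rw [hTw] at hT
      simp only [mem_biUnion, mem_image, mem_filter, mem_univ, true_and, hk]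
      exact ⟨w, hw, T.1, hT ▸ hTR, hT.symm⟩
    calc ((univ.filter (· ∈ U \ R)).card : ℝ)
        ≤ ∑ w ∈ k, ((univ.filter fun M => affThrough b w M ∉ R).card : ℝ) := by
          exact_mod_cast (card_le_card hsub).trans
            (card_biUnion_le.trans (sum_le_sum fun w _ => card_image_le))
      _ ≤ ∑ w ∈ k, ε * N := sum_le_sum fun w hw => hε w (mem_filter.1 hw).2
      _ = _ := by rw [sum_const, nsmul_eq_mul]
  have hsplit : (univ.filter (· ∈ R ∩ U)).card + (univ.filter (· ∈ U \ R)).card =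
      (univ.filter (· ∈ U)).card := by
    rw [← card_filter_add_card_filter_not (s := univ.filter (· ∈ U)) (· ∈ R), filter_filter,
      filter_filter]
    congr 2
    ext T
    simp [and_comm]
  have hUcard' : (k.card : ℝ) * J.card ≤ (univ.filter (· ∈ U)).card := by exact_mod_cast hUcard
  have hsplit' : ((univ.filter (· ∈ R ∩ U)).card : ℝ) + (univ.filter (· ∈ U \ R)).card =
      (univ.filter (· ∈ U)).card := by exact_mod_cast hsplit
  have hUpos : (0 : ℝ) < (univ.filter (· ∈ U)).card :=
    (mul_pos hkpos (by linarith)).trans_le hUcard'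
  have hRU : Nat.card ↥(R ∩ U) = (univ.filter (· ∈ R ∩ U)).card := natCard_eq_card_filter_mem _
  have hU' : Nat.card ↥U = (univ.filter (· ∈ U)).card := natCard_eq_card_filter_mem _
  rw [_root_.dens, hRU, hU', le_div_iff₀ hUpos]
  have hεk : ε * (k.card * (N : ℝ)) ≤ ε * (2 * (univ.filter (· ∈ U)).card) := by
    refine mul_le_mul_of_nonneg_left ?_ hε0
    have := mul_le_mul_of_nonneg_left hJcard hkpos.le
    linarith
  linarith

end Counting

section Typical

variable {F ι : Type} [Field F] [Fintype F] {n ℓ : ℕ} {f : (Fin n → F) → F}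
  {H : ι → (Fin ℓ → F) → F} {b : Fin n → F} {η : ℝ} {v : (Fin ℓ → F) → ι → F}

theorem IsTypicalValue.dens_detects_le (hv : IsTypicalValue f H b η v) {a : Fin ℓ → F}
    (ha : v a = 0) : _root_.dens {T | Detects f H T} {T : Aff F n ℓ | affApp T a = b} ≤ 2 * η := by
  classical
  have hC := natCard_inter_affApp_eq (Set.univ : Set (Aff F n ℓ)) a b
  rw [Set.univ_inter] at hC
  rw [_root_.dens, natCard_inter_affApp_eq, hC, div_le_iff₀]
  · simpa [detects_iff_testValues_ne_zero, ha] using hv a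
  · simpa using Fintype.card_pos

theorem IsTypicalValue.one_sub_le_dens_union (hv : IsTypicalValue f H b η v) (h : ℓ + 1 ≤ n)
    {K : Set (Fin ℓ → F)} (hK : K.Nonempty) (hvK : ∀ w ∈ K, v w ≠ 0) :
    1 - 2 * (2 * η) ≤
      _root_.dens {T | Detects f H T} {T : Aff F n ℓ | ∃ w ∈ K, affApp T w = b} := by
  classical
  refine one_sub_two_mul_le_dens_union h hK fun w hw => le_trans ?_ (hv w)
  refine Nat.cast_le.2 (card_le_card fun M hM => ?_)
  simp only [Set.mem_ofPred_eq, detects_iff_testValues_ne_zero, mem_filter, mem_univ, true_and,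
    not_not] at hM ⊢
  rw [hM]
  exact (hvK w hw).symm

theorem densityBound_of_mu_le {δ : ℝ} (h : mu {T : Aff F n ℓ | Detects f H T} ≤ δ) :
    DensityBound f H ((Fintype.card F : ℝ) ^ 5 * δ) := by
  classical
  have hpos : (0 : ℝ) < Fintype.card (Aff F n ℓ) := Nat.cast_pos.2 Fintype.card_pos
  rw [mu, natCard_eq_card_filter_mem, Nat.card_eq_fintype_card, div_le_iff₀ hpos] at h
  rw [DensityBound, mul_assoc]
  refine mul_le_mul_of_nonneg_left ?_ (by positivity)
  convert h
  rfl

end Typical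

theorem density_bounds {Q t M : ℝ} (hQ : 3 ≤ Q) (ht : t ≤ 5 * Q) (hM : 1000 ≤ M) :
    6 * (Q ^ 5 * Q ^ (-M)) < 1 ∧ 2 * (Q ^ 5 * Q ^ (-M)) * Q < 1 ∧
      2 * (2 * (Q ^ 5 * Q ^ (-M))) ≤ Q ^ (-(M / 2)) ∧
      2 * (Q ^ 5 * Q ^ (-M)) <
        1 - 1 / (Q - 1) ^ 2 - 1 / Q ^ 6 - 2000 * t * Q ^ 200 * Q ^ (-(M / 4)) := by
  have hQ0 : 0 < Q := by linarith
  have hQ1 : 1 ≤ Q := by linarith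
  have hpow : ∀ (x : ℝ) (m : ℕ), x ≤ -(m : ℝ) → Q ^ x * Q ^ m ≤ 1 := by
    intro x m hx
    rw [← Real.rpow_natCast, ← Real.rpow_add hQ0]
    exact Real.rpow_le_one_of_one_le_of_nonpos hQ1 (by linarith)
  set y := Q ^ (-(M / 2)) with hy
  set z := Q ^ (-(M / 4)) with hz
  have hy0 : 0 ≤ y := Real.rpow_nonneg hQ0.le _
  have hz0 : 0 ≤ z := Real.rpow_nonneg hQ0.le _
  have hyM : Q ^ (-M) = y * y := by
    rw [hy, ← Real.rpow_add hQ0]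
    congr 1
    ring
  have hy7 : y * Q ^ 7 ≤ 1 := hpow _ _ (by push_cast; linarith)
  have hz250 : z * Q ^ 250 ≤ 1 := hpow _ _ (by push_cast; linarith)
  rw [hyM]
  have hQ2 : 9 ≤ Q ^ 2 := by nlinarith
  have hyQ5 : 9 * (y * Q ^ 5) ≤ 1 := by
    have : 9 * (y * Q ^ 5) ≤ Q ^ 2 * (y * Q ^ 5) :=
      mul_le_mul_of_nonneg_right hQ2 (by positivity)
    linarith [show Q ^ 2 * (y * Q ^ 5) = y * Q ^ 7 by ring]
  have hη : 9 * (Q ^ 5 * (y * y)) ≤ y := by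
    nlinarith
  have hyQ : y * Q ≤ 1 / 9 := by
    have : y * Q ≤ y * Q ^ 5 := mul_le_mul_of_nonneg_left (le_self_pow₀ hQ1 (by norm_num)) hy0
    linarith
  have hyle : y ≤ 1 / 9 := by nlinarith
  have hzQ : 2000 * t * Q ^ 200 * z ≤ 1 / 10 := by
    have h49 : (10 : ℝ) ^ 5 ≤ Q ^ 49 :=
      (by norm_num : (10 : ℝ) ^ 5 ≤ 3 ^ 49).trans (pow_le_pow_left₀ (by norm_num) hQ 49)
    have h1 : 2000 * t * Q ^ 200 * z ≤ 2000 * (5 * Q) * Q ^ 200 * z := by gcongr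
    have h2 : (10 : ℝ) ^ 5 * (Q ^ 201 * z) ≤ Q ^ 49 * (Q ^ 201 * z) :=
      mul_le_mul_of_nonneg_right h49 (by positivity)
    have h3 : Q ^ 49 * (Q ^ 201 * z) = z * Q ^ 250 := by ring
    have h4 : 2000 * (5 * Q) * Q ^ 200 * z = 10 ^ 4 * (Q ^ 201 * z) := by ring
    linarith
  have h4 : 1 / (Q - 1) ^ 2 ≤ 1 / 4 := one_div_le_one_div_of_le (by norm_num) (by nlinarith)
  have h6 : 1 / Q ^ 6 ≤ 1 / 4 :=
    one_div_le_one_div_of_le (by norm_num)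
      ((by norm_num : (4 : ℝ) ≤ 3 ^ 6).trans (pow_le_pow_left₀ (by norm_num) hQ 6))
  refine ⟨by linarith, by nlinarith, by linarith, by linarith⟩

/-- There is an absolute constant `M₀` such that for all `M ≥ M₀`: if
`0 < μ(S_t) ≤ q^{-M}` and `S_t` is dense in some zoom-in `C_{a,b}` with `a ∈ supp(H)`, then
`S_t` is dense in the union `∪_{v ∈ supp(H)} C_{v,b}`. -/
theorem dense_on_support_union :
    ∃ M₀ : ℝ, ∀ M : ℝ, M₀ ≤ M →
    ∀ (p k : ℕ) (hp : p.Prime), 1 ≤ k →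
    ∀ (F : Type) [Field F] [Fintype F],
    ∀ q : ℕ, q = p ^ k → Fintype.card F = q →
    ∀ d s r : ℕ, p ∣ s → 0 < r → r ≤ p * (q - q / p) → d + 1 = s * (q - q / p) + r →
    ∀ t : ℕ, t = max (p + 2) 10 →
    ∀ P : MvPolynomial (Fin p) F, Pdef p q hp.pos P →
    ∀ n : ℕ, s + t + 110 ≤ n →
    ∀ f : (Fin n → F) → F,
      0 < mu {T : Aff F n (s + t) | rejects P q s r t n f T} →
      mu {T : Aff F n (s + t) | rejects P q s r t n f T} ≤ (q : ℝ) ^ (-M) →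
    ∀ b : Fin n → F,
      (∃ a ∈ suppH P q s t,
        1 - 1 / ((q : ℝ) - 1) ^ 2 - 1 / (q : ℝ) ^ 6 -
            2000 * (t : ℝ) * (q : ℝ) ^ 200 * (q : ℝ) ^ (-(M / 4)) ≤
          dens {T : Aff F n (s + t) | rejects P q s r t n f T}
            {T : Aff F n (s + t) | affApp T a = b}) →
      1 - 1 / ((q : ℝ) - 1) ^ 2 - 1 / (q : ℝ) ^ 6 - 2 / ((q : ℝ) ^ 100 * ((q : ℝ) - 1)) -
          2000 * (t : ℝ) * (q : ℝ) ^ 200 * (q : ℝ) ^ (-(M / 4)) - (q : ℝ) ^ (-(M / 2)) ≤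
        dens {T : Aff F n (s + t) | rejects P q s r t n f T}
          {T : Aff F n (s + t) | ∃ v ∈ suppH P q s t, affApp T v = b} := by
  refine ⟨1000, fun M hM p k hp hk F _ _ q hqk hqF _ s r hps _ _ _ t ht P hP n hn f _ hμ b h => ?_⟩
  subst hqF
  have := Fact.mk hp
  have : CharP F p := charP_of_card_eq_prime_pow hqk
  have hpF : p ≤ Fintype.card F := hqk ▸ Nat.le_self_pow (by omega) p
  have htF : (t : ℝ) ≤ 5 * Fintype.card F := by
    have hF2 := Fintype.one_lt_card (α := F)
    exact_mod_cast (show t ≤ 5 * Fintype.card F by omega)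
  obtain ⟨a, ha, hdens⟩ := h
  rcases (Nat.succ_le_of_lt (Fintype.one_lt_card (α := F))).eq_or_lt with h2 | h3
  · have hF : (Fintype.card F : ℝ) = 2 := by exact_mod_cast h2.symm
    refine le_trans ?_ (div_nonneg (Nat.cast_nonneg _) (Nat.cast_nonneg _))
    rw [hF]
    have h1 := Real.rpow_nonneg (zero_le_two (α := ℝ)) (-(M / 4))
    have h2 := Real.rpow_nonneg (zero_le_two (α := ℝ)) (-(M / 2))
    have h3 : 0 ≤ 2000 * (t : ℝ) * 2 ^ 200 * 2 ^ (-(M / 4)) := by positivity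
    have h4 : (0 : ℝ) ≤ 2 / (2 ^ 100 * (2 - 1)) := by norm_num
    have h5 : (1 : ℝ) - 1 / (2 - 1) ^ 2 - 1 / 2 ^ 6 ≤ 0 := by norm_num
    linarith
  · have hQ : (3 : ℝ) ≤ Fintype.card F := by exact_mod_cast h3
    have hR : {T : Aff F n (s + t) | rejects P (Fintype.card F) s r t n f T} =
        {T | Detects f (validHfun P (Fintype.card F) r s t) T} := by
      ext T
      simp only [rejects, Detects, validHfun, Set.mem_ofPred_eq, Subtype.exists, exists_prop]
    rw [hR] at hμ hdens ⊢
    obtain ⟨hη6, hηF, hη4, hη2⟩ := density_bounds hQ htF hM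
    have hbound := densityBound_of_mu_le hμ
    obtain ⟨v, hv⟩ := hbound.exists_isTypicalValue b
    have hva : v a ≠ 0 := fun h0 => (hη2.trans_le hdens).not_ge (hv.dens_detects_le h0)
    refine le_trans ?_ (hv.one_sub_le_dens_union (by omega) ⟨a, ha⟩ fun w hw =>
      hv.ne_zero_of_mem_suppH hbound hη6 hηF hP hp.two_le hpF hps hva hw)
    have h1 := Real.rpow_nonneg (zero_le_three.trans hQ) (-(M / 4))
    have h2 : (0 : ℝ) ≤ Fintype.card F - 1 := by linarith
    have h3 : 0 ≤ 2000 * (t : ℝ) * (Fintype.card F : ℝ) ^ 200 *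
      (Fintype.card F : ℝ) ^ (-(M / 4)) := by positivity
    have h4 : 0 ≤ 1 / ((Fintype.card F : ℝ) - 1) ^ 2 := by positivity
    have h5 : 0 ≤ 1 / (Fintype.card F : ℝ) ^ 6 := by positivity
    have h6 : 0 ≤ 2 / ((Fintype.card F : ℝ) ^ 100 * ((Fintype.card F : ℝ) - 1)) := by positivity
    linarith

end
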